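/- arXiv:2202.01959 — 2 statements merged into one kernel-verified Lean document; each statement's English description precedes it below -/
import Mathlib

section
/- Let L_n denote the set of FAS structures with universe {1,…,n}, and let S_n ⊆ L_n denote the set of those structures in L_n that are symmetric and integral. Then the ratio |S_n|/|L_n| tends to 1 as n → ∞. -/
open Filter Topology

/-- Labelled FAS-type data on the universe `Fin n`: a unary function `f`,
a set `I` of identity atoms, and a ternary relation `T`. -/
abbrev FASData (n : ℕ) :=
  (Fin n → Fin n) × Finset (Fin n) × Finset (Fin n × Fin n × Fin n)

/-- The conditions (P) and (I) defining FAS structures. -/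
def IsFAS {n : ℕ} (M : FASData n) : Prop :=
  (∀ a b c : Fin n, (a, b, c) ∈ M.2.2 → (M.1 a, c, b) ∈ M.2.2 ∧ (c, M.1 b, a) ∈ M.2.2) ∧
  (∀ a b : Fin n, a = b ↔ ∃ i ∈ M.2.1, (a, i, b) ∈ M.2.2)

/-- A structure is symmetric iff `f` is the identity. -/
def FASSymmetric {n : ℕ} (M : FASData n) : Prop := ∀ x, M.1 x = x

/-- A structure is integral iff `|I| = 1`. -/
def FASIntegral {n : ℕ} (M : FASData n) : Prop := M.2.1.card = 1


open Equiv in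
/-- The action of `S₃` on triples which permutes coordinates and, for odd permutations, also
applies the involution `g` to every coordinate. -/
abbrev twistedAction {V : Type*} {g : V → V} (hg : Function.Involutive g) :
    MulAction (Perm (Fin 3)) (Fin 3 → V) where
  smul π x := fun j => if Perm.sign π = 1 then x (π⁻¹ j) else g (x (π⁻¹ j))
  one_smul x := by
    funext j
    change (if Perm.sign (1 : Perm (Fin 3)) = 1 then _ else _) = _
    simp
  mul_smul π ρ x := by
    funext j
    change (if Perm.sign (π * ρ) = 1 then x ((π * ρ)⁻¹ j) else g (x ((π * ρ)⁻¹ j))) =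
      if Perm.sign π = 1 then (if Perm.sign ρ = 1 then x (ρ⁻¹ (π⁻¹ j)) else g (x (ρ⁻¹ (π⁻¹ j))))
      else g (if Perm.sign ρ = 1 then x (ρ⁻¹ (π⁻¹ j)) else g (x (ρ⁻¹ (π⁻¹ j))))
    rcases Int.units_eq_one_or (Perm.sign π) with h | h <;>
      rcases Int.units_eq_one_or (Perm.sign ρ) with h' | h' <;>
      simp [h, h', hg _]

section
open Equiv

lemma twistedAction_smul_apply {V : Type*} {g : V → V} (hg : Function.Involutive g)
    (π : Perm (Fin 3)) (x : Fin 3 → V) (j : Fin 3) :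
    (letI := twistedAction hg; π • x) j =
      if Perm.sign π = 1 then x (π⁻¹ j) else g (x (π⁻¹ j)) := rfl

lemma univ_perm_fin_three : (Finset.univ : Finset (Perm (Fin 3))) =
    {1, swap 0 1, swap 0 2, swap 1 2, swap 0 1 * swap 1 2, swap 1 2 * swap 0 1} := by
  decide

lemma card_fixedBy_swap {V : Type*} [Fintype V] {g : V → V} (hg : Function.Involutive g)
    {i j k : Fin 3} (hij : i ≠ j) (hik : i ≠ k) (hjk : j ≠ k) :
    Nat.card (letI := twistedAction hg; MulAction.fixedBy (Fin 3 → V) (swap i j)) =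
      Fintype.card V * Nat.card {x : V // g x = x} := by
  let := twistedAction hg
  have cover : ∀ l : Fin 3, l = i ∨ l = j ∨ l = k := by omega
  have key (x : Fin 3 → V) : x ∈ MulAction.fixedBy (Fin 3 → V) (swap i j) ↔
      x j = g (x i) ∧ g (x k) = x k := by
    rw [MulAction.mem_fixedBy, funext_iff]
    simp only [twistedAction_smul_apply, Perm.sign_swap hij, swap_inv]
    refine ⟨fun h => ⟨?_, ?_⟩, fun h l => ?_⟩
    · simpa using (h j).symm
    · simpa [swap_apply_of_ne_of_ne hik.symm hjk.symm] using h k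
    · rcases cover l with rfl | rfl | rfl
      · simp [h.1, hg _]
      · simp [h.1]
      · simp [swap_apply_of_ne_of_ne hik.symm hjk.symm, h.2]
  let e : MulAction.fixedBy (Fin 3 → V) (swap i j) ≃ V × {x : V // g x = x} :=
    { toFun := fun x => (x.1 i, ⟨x.1 k, ((key x.1).1 x.2).2⟩)
      invFun := fun p => ⟨fun l => if l = i then p.1 else if l = j then g p.1 else p.2, by
        rw [key]
        simp [hij.symm, hik.symm, hjk.symm, p.2.2]⟩
      left_inv := by
        rintro ⟨x, hx⟩
        have hx' := (key x).1 hx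
        ext l
        rcases cover l with rfl | rfl | rfl
        · simp
        · simp [hij.symm, hx'.1]
        · simp [hik.symm, hjk.symm]
      right_inv := by
        rintro ⟨v, w, hw⟩
        simp [hik.symm, hjk.symm] }
  rw [Nat.card_congr e, Nat.card_prod, Nat.card_eq_fintype_card]

lemma card_fixedBy_cycle {V : Type*} [Fintype V] {g : V → V} (hg : Function.Involutive g)
    {π : Perm (Fin 3)} (h1 : Perm.sign π = 1) (h0 : π⁻¹ 1 = 0) (h : π⁻¹ 2 = 1) :
    Nat.card (letI := twistedAction hg; MulAction.fixedBy (Fin 3 → V) π) = Fintype.card V := by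
  let := twistedAction hg
  have h2 : π⁻¹ 0 = 2 := by
    revert h0 h
    generalize π⁻¹ = ρ
    revert ρ
    decide
  have key (x : Fin 3 → V) : x ∈ MulAction.fixedBy (Fin 3 → V) π ↔ x 0 = x 1 ∧ x 1 = x 2 := by
    rw [MulAction.mem_fixedBy, funext_iff]
    simp only [twistedAction_smul_apply, h1, if_true, Fin.forall_fin_succ, Fin.isValue,
      Fin.succ_zero_eq_one, Fin.succ_one_eq_two, h0, h, h2]
    constructor
    · rintro ⟨-, h, h', -⟩
      exact ⟨h, h'⟩
    · rintro ⟨h, h'⟩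
      exact ⟨(h.trans h').symm, h, h', fun i => i.elim0⟩
  let e : MulAction.fixedBy (Fin 3 → V) π ≃ V :=
    { toFun := fun x => x.1 0
      invFun := fun v => ⟨fun _ => v, by simp [key]⟩
      left_inv := by
        rintro ⟨x, hx⟩
        have hx' := (key x).1 hx
        ext l
        fin_cases l
        · rfl
        · exact hx'.1
        · exact hx'.1.trans hx'.2
      right_inv := fun v => rfl }
  rw [Nat.card_congr e, Nat.card_eq_fintype_card]

/-- The number of orbits of the twisted action, by Burnside's lemma. -/
lemma six_mul_card_orbits {V : Type*} [Fintype V] {g : V → V} (hg : Function.Involutive g) :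
    6 * Nat.card (letI := twistedAction hg; MulAction.orbitRel.Quotient (Perm (Fin 3)) (Fin 3 → V)) =
      Fintype.card V ^ 3 + 3 * (Fintype.card V * Nat.card {x : V // g x = x})
        + 2 * Fintype.card V := by
  classical
  let := twistedAction hg
  have key := MulAction.sum_card_fixedBy_eq_card_orbits_mul_card_group (Perm (Fin 3)) (Fin 3 → V)
  simp only [← Nat.card_eq_fintype_card] at key
  rw [univ_perm_fin_three] at key
  repeat rw [Finset.sum_insert (by decide)] at key
  rw [Finset.sum_singleton] at key
  rw [card_fixedBy_swap hg (k := 2) (by decide) (by decide) (by decide),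
    card_fixedBy_swap hg (k := 1) (by decide) (by decide) (by decide),
    card_fixedBy_swap hg (k := 0) (by decide) (by decide) (by decide)] at key
  rw [show MulAction.fixedBy (Fin 3 → V) (swap 1 2 * swap 0 1 : Perm (Fin 3)) =
      MulAction.fixedBy (Fin 3 → V) (swap 0 1 * swap 1 2 : Perm (Fin 3)) by
        rw [← MulAction.fixedBy_inv, mul_inv_rev, swap_inv, swap_inv],
    MulAction.fixedBy_one_eq_univ,
    card_fixedBy_cycle hg (by decide) (by decide) (by decide), Nat.card_univ,
    Nat.card_fun, Nat.card_perm, Nat.card_fin, Nat.card_eq_fintype_card (α := V)] at key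
  have h6 : Nat.factorial 3 = 6 := rfl
  rw [h6] at key
  change 6 * Nat.card (Quotient (MulAction.orbitRel (Perm (Fin 3)) (Fin 3 → V))) = _
  linarith
end

/-- Closure of a set of triples under the Peircean transformations given by `g`. -/
def PeirceClosed {V : Type*} (g : V → V) (T : Finset (V × V × V)) : Prop :=
  ∀ a b c : V, (a, b, c) ∈ T → (g a, c, b) ∈ T ∧ (c, g b, a) ∈ T

/-- The orbit of a triple, after applying `g` to its last entry, under the twisted action. -/
def peirceClass {V : Type*} {g : V → V} (hg : Function.Involutive g) (t : V × V × V) :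
    letI := twistedAction hg
    MulAction.orbitRel.Quotient (Equiv.Perm (Fin 3)) (Fin 3 → V) :=
  letI := twistedAction hg
  Quotient.mk _ ![t.1, t.2.1, g t.2.2]

lemma peirceClass_surjective {V : Type*} {g : V → V} (hg : Function.Involutive g) :
    Function.Surjective (peirceClass hg) := by
  let := twistedAction hg
  intro q
  obtain ⟨x, rfl⟩ := Quotient.exists_rep q
  refine ⟨(x 0, x 1, g (x 2)), ?_⟩
  change Quotient.mk _ ![x 0, x 1, g (g (x 2))] = _
  congr 1
  funext j
  fin_cases j
  · rfl
  · rfl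
  · exact hg _

lemma peirceClass_eq_iff {V : Type*} {g : V → V} (hg : Function.Involutive g)
    (s t : V × V × V) : peirceClass hg s = peirceClass hg t ↔
      ∃ π : Equiv.Perm (Fin 3), ∀ j, (if Equiv.Perm.sign π = 1
        then ![t.1, t.2.1, g t.2.2] (π⁻¹ j) else g (![t.1, t.2.1, g t.2.2] (π⁻¹ j))) =
          ![s.1, s.2.1, g s.2.2] j := by
  let := twistedAction hg
  refine Quotient.eq.trans ?_
  change (∃ π : Equiv.Perm (Fin 3), π • ![t.1, t.2.1, g t.2.2] = ![s.1, s.2.1, g s.2.2]) ↔ _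
  simp only [funext_iff, twistedAction_smul_apply]

lemma peirceClass_transform {V : Type*} {g : V → V} (hg : Function.Involutive g) (a b c : V) :
    peirceClass hg (g a, c, b) = peirceClass hg (a, b, c) ∧
      peirceClass hg (c, g b, a) = peirceClass hg (a, b, c) := by
  constructor
  · refine (peirceClass_eq_iff hg _ _).2 ⟨Equiv.swap 1 2, fun j => ?_⟩
    rw [Equiv.Perm.sign_swap (by decide), Equiv.swap_inv]
    fin_cases j <;> simp [hg _, Equiv.swap_apply_of_ne_of_ne]
  · refine (peirceClass_eq_iff hg _ _).2 ⟨Equiv.swap 0 2, fun j => ?_⟩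
    rw [Equiv.Perm.sign_swap (by decide), Equiv.swap_inv]
    fin_cases j <;> simp [hg _, Equiv.swap_apply_of_ne_of_ne]

lemma PeirceClosed.mem_of_peirceClass_eq {V : Type*} {g : V → V} (hg : Function.Involutive g)
    {T : Finset (V × V × V)} (hT : PeirceClosed g T) {s t : V × V × V}
    (hst : peirceClass hg s = peirceClass hg t) (ht : t ∈ T) : s ∈ T := by
  obtain ⟨π, hπ⟩ := (peirceClass_eq_iff hg s t).1 hst
  obtain ⟨a, b, c⟩ := s
  obtain ⟨x, y, z⟩ := t
  have hσ {u v w : V} (h : (u, v, w) ∈ T) : (g u, w, v) ∈ T := (hT u v w h).1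
  have hτ {u v w : V} (h : (u, v, w) ∈ T) : (w, g v, u) ∈ T := (hT u v w h).2
  have h0 := hπ 0
  have h1 := hπ 1
  have h2 := hπ 2
  have hmem := Finset.mem_univ π
  rw [univ_perm_fin_three] at hmem
  simp only [Finset.mem_insert, Finset.mem_singleton] at hmem
  rcases hmem with rfl | rfl | rfl | rfl | rfl | rfl <;>
    simp [Equiv.swap_apply_def, Equiv.Perm.sign_swap', hg _,
      hg.injective.eq_iff] at h0 h1 h2
  · rwa [← h0, ← h1, ← h2]
  · have hc : g z = c := by rw [h2, hg]
    rw [← h0, ← h1, ← hc]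
    exact hσ (hτ (hσ ht))
  · rw [← h0, ← h1, ← h2]
    exact hτ ht
  · rw [← h0, ← h1, ← h2]
    exact hσ ht
  · have hc : g y = c := by rw [h2, hg]
    rw [← h0, ← h1, ← hc]
    exact hσ (hτ ht)
  · have hc : g x = c := by rw [h2, hg]
    rw [← h0, ← h1, ← hc]
    exact hτ (hσ ht)

lemma card_peirceClosed {V : Type*} [Fintype V] {g : V → V} (hg : Function.Involutive g) :
    Nat.card {T : Finset (V × V × V) // PeirceClosed g T} =
      2 ^ Nat.card (letI := twistedAction hg;
        MulAction.orbitRel.Quotient (Equiv.Perm (Fin 3)) (Fin 3 → V)) := by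
  classical
  let := twistedAction hg
  let Q := MulAction.orbitRel.Quotient (Equiv.Perm (Fin 3)) (Fin 3 → V)
  let : Fintype Q := Fintype.ofFinite Q
  let e : {T : Finset (V × V × V) // PeirceClosed g T} ≃ Finset Q :=
    { toFun := fun T => T.1.image (peirceClass hg)
      invFun := fun A => ⟨Finset.univ.filter fun t => peirceClass hg t ∈ A, by
        intro a b c h
        simpa [peirceClass_transform hg a b c] using h⟩
      left_inv := by
        rintro ⟨T, hT⟩
        ext s
        simp only [Finset.mem_image, Finset.mem_filter, Finset.mem_univ, true_and]
        exact ⟨fun ⟨t, ht, hst⟩ => hT.mem_of_peirceClass_eq hg hst.symm ht, fun h => ⟨s, h, rfl⟩⟩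
      right_inv := by
        intro A
        ext q
        obtain ⟨t, rfl⟩ := peirceClass_surjective hg q
        simp only [Finset.mem_image, Finset.mem_filter, Finset.mem_univ, true_and]
        exact ⟨fun ⟨s, hs, hst⟩ => hst ▸ hs, fun h => ⟨t, h, rfl⟩⟩ }
  rw [Nat.card_congr e, Nat.card_eq_fintype_card, Fintype.card_finset, Nat.card_eq_fintype_card]

lemma card_peirceClosed_rpow {V : Type*} [Fintype V] {g : V → V} (hg : Function.Involutive g) :
    (Nat.card {T : Finset (V × V × V) // PeirceClosed g T} : ℝ) =
      (2 : ℝ) ^ (((Fintype.card V : ℝ) ^ 3 + 3 * (Fintype.card V * Nat.card {x : V // g x = x})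
        + 2 * Fintype.card V) / 6) := by
  have h := six_mul_card_orbits hg
  rw [card_peirceClosed hg, Nat.cast_pow, ← Real.rpow_natCast]
  congr 1
  rw [eq_div_iff (by norm_num), mul_comm]
  exact_mod_cast h

namespace IsFAS

variable {n : ℕ} {f : Fin n → Fin n} {I : Finset (Fin n)} {T : Finset (Fin n × Fin n × Fin n)}

lemma involutive (h : IsFAS (f, I, T)) : Function.Involutive f := by
  intro a
  obtain ⟨i, hi, hT⟩ := (h.2 a a).1 rfl
  exact (h.2 _ _).2 ⟨i, hi, (h.1 _ _ _ (h.1 _ _ _ hT).1).1⟩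

lemma map_eq_self (h : IsFAS (f, I, T)) {i : Fin n} (hi : i ∈ I) : f i = i := by
  obtain ⟨j, hj, hT⟩ := (h.2 i i).1 rfl
  have hij : f i = j := (h.2 _ _).2 ⟨i, hi, (h.1 _ _ _ hT).1⟩
  have hT' := (h.1 _ _ _ hT).2
  simp only at hij hT'
  rw [← hij, h.involutive i] at hT'
  exact (h.2 _ _).2 ⟨i, hi, (h.1 _ _ _ hT').1⟩

lemma nonempty (h : IsFAS (f, I, T)) (hn : n ≠ 0) : I.Nonempty := by
  obtain ⟨i, hi, -⟩ := (h.2 ⟨0, Nat.pos_of_ne_zero hn⟩ _).1 rfl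
  exact ⟨i, hi⟩

lemma map_notMem (h : IsFAS (f, I, T)) {x : Fin n} (hx : x ∉ I) : f x ∉ I := fun hfx =>
  hx (by rwa [← h.involutive x, h.map_eq_self hfx])

lemma mem_iff_left (h : IsFAS (f, I, T)) (a b c : Fin n) :
    (a, b, c) ∈ T ↔ (f a, c, b) ∈ T :=
  ⟨fun hT => (h.1 _ _ _ hT).1, fun hT => by
    have := (h.1 _ _ _ hT).1
    simp only at this
    rwa [h.involutive] at this⟩

lemma mem_iff_right (h : IsFAS (f, I, T)) (a b c : Fin n) :
    (a, b, c) ∈ T ↔ (c, f b, a) ∈ T :=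
  ⟨fun hT => (h.1 _ _ _ hT).2, fun hT => by
    have := (h.1 _ _ _ hT).2
    simp only at this
    rwa [h.involutive] at this⟩

lemma mem_iff_of_mid_mem (h : IsFAS (f, I, T)) {a b c : Fin n} (hb : b ∈ I) :
    (a, b, c) ∈ T ↔ a = c ∧ (a, b, a) ∈ T := by
  constructor
  · intro hT
    obtain rfl := (h.2 a c).2 ⟨b, hb, hT⟩
    exact ⟨rfl, hT⟩
  · rintro ⟨rfl, hT⟩
    exact hT

/-- A structure with given `f` and `I` is determined by its triples avoiding `I` and its
triples of the form `(a, i, a)` with `i ∈ I`. -/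
lemma ext_of_eq {T' : Finset (Fin n × Fin n × Fin n)} (h : IsFAS (f, I, T))
    (h' : IsFAS (f, I, T'))
    (hV : ∀ a b c, a ∉ I → b ∉ I → c ∉ I → ((a, b, c) ∈ T ↔ (a, b, c) ∈ T'))
    (hI : ∀ a, ∀ i ∈ I, ((a, i, a) ∈ T ↔ (a, i, a) ∈ T')) : T = T' := by
  have hmid (a b c : Fin n) (hb : b ∈ I) : (a, b, c) ∈ T ↔ (a, b, c) ∈ T' := by
    rw [h.mem_iff_of_mid_mem hb, h'.mem_iff_of_mid_mem hb, hI a b hb]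
  have hlast (a b c : Fin n) (hc : c ∈ I) : (a, b, c) ∈ T ↔ (a, b, c) ∈ T' := by
    rw [h.mem_iff_left, h'.mem_iff_left, hmid _ _ _ hc]
  ext ⟨a, b, c⟩
  by_cases hb : b ∈ I
  · exact hmid a b c hb
  by_cases hc : c ∈ I
  · exact hlast a b c hc
  by_cases ha : a ∈ I
  · rw [h.mem_iff_right, h'.mem_iff_right, hlast _ _ _ ha]
  · exact hV a b c ha hb hc

/-- The restriction of `f` to the complement of `I`. -/
def restrict (h : IsFAS (f, I, T)) (x : {x // x ∉ I}) : {x // x ∉ I} :=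
  ⟨f x, h.map_notMem x.2⟩

lemma restrict_involutive (h : IsFAS (f, I, T)) : Function.Involutive h.restrict :=
  fun x => Subtype.ext (h.involutive x)

lemma card_fixed_add_card_moved (h : IsFAS (f, I, T)) :
    Nat.card {x : {x // x ∉ I} // h.restrict x = x} + (Finset.univ.filter fun x => f x ≠ x).card
      + I.card = n := by
  have e1 : Nat.card {x : {x // x ∉ I} // h.restrict x = x} =
      (Finset.univ.filter fun x => x ∉ I ∧ f x = x).card := by
    rw [← Fintype.card_subtype, ← Nat.card_eq_fintype_card]
    refine Nat.card_congr ?_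
    exact
    { toFun := fun x => ⟨x.1.1, x.1.2, congrArg Subtype.val x.2⟩
      invFun := fun x => ⟨⟨x.1, x.2.1⟩, Subtype.ext x.2.2⟩
      left_inv := fun x => rfl
      right_inv := fun x => rfl }
  have e2 : (Finset.univ.filter fun x => x ∉ I ∧ f x = x) =
      (Finset.univ.filter fun x => f x = x) \ I := by
    ext x
    simp [and_comm]
  have hsub : I ⊆ Finset.univ.filter fun x => f x = x := fun i hi => by
    simpa using h.map_eq_self hi
  have e3 := Finset.card_filter_add_card_filter_not (s := (Finset.univ : Finset (Fin n)))
    (fun x => f x = x)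
  have e4 := Finset.card_sdiff_add_card_eq_card hsub
  rw [Finset.card_univ, Fintype.card_fin] at e3
  rw [e1, e2]
  simp only [ne_eq]
  omega

/-- Bound on the number of FAS structures with given `f` and `I`. -/
lemma card_le (h : IsFAS (f, I, T)) :
    Nat.card {T' // IsFAS (f, I, T')} ≤
      Nat.card {R : Finset ({x // x ∉ I} × {x // x ∉ I} × {x // x ∉ I}) //
        PeirceClosed h.restrict R} * (2 ^ I.card - 1) ^ n := by
  classical
  have hcard : Nat.card (Fin n → {J // J ∈ I.powerset.erase ∅}) = (2 ^ I.card - 1) ^ n := by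
    rw [Nat.card_fun, Nat.card_fin, Nat.card_eq_fintype_card, Fintype.card_coe,
      Finset.card_erase_of_mem (Finset.empty_mem_powerset I), Finset.card_powerset]
  rw [← hcard, ← Nat.card_prod]
  let F : {T' // IsFAS (f, I, T')} →
      {R : Finset ({x // x ∉ I} × {x // x ∉ I} × {x // x ∉ I}) // PeirceClosed h.restrict R} ×
        (Fin n → {J // J ∈ I.powerset.erase ∅}) := fun S =>
    (⟨Finset.univ.filter fun t => (t.1.1, t.2.1.1, t.2.2.1) ∈ S.1, by
        intro a b c habc
        simp only [Finset.mem_filter, Finset.mem_univ, true_and] at habc ⊢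
        exact S.2.1 _ _ _ habc⟩,
      fun a => ⟨I.filter fun i => (a, i, a) ∈ S.1, by
        obtain ⟨i, hi, hT⟩ := (S.2.2 a a).1 rfl
        rw [Finset.mem_erase, Finset.mem_powerset]
        exact ⟨Finset.ne_empty_of_mem (Finset.mem_filter.2 ⟨hi, hT⟩), Finset.filter_subset _ _⟩⟩)
  refine Nat.card_le_card_of_injective F ?_
  rintro ⟨T₁, h₁⟩ ⟨T₂, h₂⟩ hF
  obtain ⟨hF1, hF2⟩ := Prod.ext_iff.1 hF
  refine Subtype.ext (h₁.ext_of_eq h₂ (fun a b c ha hb hc => ?_) (fun a i hi => ?_))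
  · simpa [F] using Finset.ext_iff.1 (Subtype.ext_iff.1 hF1) (⟨a, ha⟩, ⟨b, hb⟩, ⟨c, hc⟩)
  · simpa [F, hi] using Finset.ext_iff.1 (Subtype.ext_iff.1 (congrFun hF2 a)) i

end IsFAS

/-- Adjoining an identity element `e` to a set of triples on the complement of `e`. -/
def adjoinIdentity {n : ℕ} (e : Fin n)
    (R : Finset ({x // x ≠ e} × {x // x ≠ e} × {x // x ≠ e})) :
    Finset (Fin n × Fin n × Fin n) :=
  (R.map ⟨fun t => (t.1.1, t.2.1.1, t.2.2.1), fun s t h => by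
      simpa [Prod.ext_iff, Subtype.ext_iff] using h⟩) ∪
    Finset.univ.filter fun t => (t.1 = e ∧ t.2.1 = t.2.2) ∨ (t.2.1 = e ∧ t.1 = t.2.2) ∨
      (t.2.2 = e ∧ t.1 = t.2.1)

lemma mem_adjoinIdentity {n : ℕ} {e : Fin n}
    {R : Finset ({x // x ≠ e} × {x // x ≠ e} × {x // x ≠ e})} {a b c : Fin n} :
    (a, b, c) ∈ adjoinIdentity e R ↔
      (∃ (ha : a ≠ e) (hb : b ≠ e) (hc : c ≠ e), (⟨a, ha⟩, ⟨b, hb⟩, ⟨c, hc⟩) ∈ R) ∨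
        (a = e ∧ b = c) ∨ (b = e ∧ a = c) ∨ (c = e ∧ a = b) := by
  simp only [adjoinIdentity, Finset.mem_union, Finset.mem_map, Finset.mem_filter,
    Finset.mem_univ, true_and]
  refine or_congr ⟨?_, ?_⟩ Iff.rfl
  · rintro ⟨⟨x, y, z⟩, h, heq⟩
    obtain ⟨rfl, rfl, rfl⟩ : x.1 = a ∧ y.1 = b ∧ z.1 = c := by
      simpa [Prod.ext_iff] using (show (x.1, y.1, z.1) = (a, b, c) from heq)
    exact ⟨x.2, y.2, z.2, h⟩
  · rintro ⟨ha, hb, hc, h⟩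
    exact ⟨_, h, rfl⟩

lemma isFAS_adjoinIdentity {n : ℕ} (e : Fin n)
    {R : Finset ({x // x ≠ e} × {x // x ≠ e} × {x // x ≠ e})} (hR : PeirceClosed id R) :
    IsFAS (id, {e}, adjoinIdentity e R) := by
  refine ⟨fun a b c h => ?_, fun a b => ?_⟩
  · simp only [mem_adjoinIdentity, id] at h ⊢
    rcases h with ⟨ha, hb, hc, h⟩ | h | h | h
    · exact ⟨Or.inl ⟨ha, hc, hb, (hR _ _ _ h).1⟩, Or.inl ⟨hc, hb, ha, (hR _ _ _ h).2⟩⟩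
    all_goals grind
  · simp only [Finset.mem_singleton, exists_eq_left, mem_adjoinIdentity]
    grind

/-- The binomial coefficient `choose (x + 2) 3` as a polynomial: the number of multisets of size
three in a set of size `x`. -/
noncomputable def tripleCount (x : ℝ) : ℝ := (x ^ 3 + 3 * x ^ 2 + 2 * x) / 6

lemma card_symmetric_integral_ge {n : ℕ} (hn : n ≠ 0) :
    (n : ℝ) * 2 ^ tripleCount (n - 1) ≤
      Nat.card {M : FASData n // IsFAS M ∧ FASSymmetric M ∧ FASIntegral M} := by
  let F : (Σ e : Fin n, {R : Finset ({x // x ≠ e} × {x // x ≠ e} × {x // x ≠ e}) //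
      PeirceClosed id R}) → {M : FASData n // IsFAS M ∧ FASSymmetric M ∧ FASIntegral M} :=
    fun p => ⟨(id, {p.1}, adjoinIdentity p.1 p.2.1), isFAS_adjoinIdentity _ p.2.2,
      fun _ => rfl, Finset.card_singleton _⟩
  have hF : Function.Injective F := by
    rintro ⟨e, R, hR⟩ ⟨e', R', hR'⟩ h
    simp only [F, Subtype.mk.injEq, Prod.mk.injEq, true_and, Finset.singleton_inj] at h
    obtain ⟨rfl, h⟩ := h
    congr 2
    ext ⟨⟨a, ha⟩, ⟨b, hb⟩, ⟨c, hc⟩⟩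
    have := Finset.ext_iff.1 h (a, b, c)
    simpa [mem_adjoinIdentity, ha, hb, hc] using this
  have hcard := Nat.card_le_card_of_injective F hF
  rw [Nat.card_sigma] at hcard
  refine le_trans (le_of_eq ?_) (Nat.cast_le.2 hcard)
  push_cast
  have hterm (e : Fin n) := card_peirceClosed_rpow
    (g := (id : {x // x ≠ e} → {x // x ≠ e})) (fun _ => rfl)
  have hV (e : Fin n) : (Fintype.card {x // x ≠ e} : ℝ) = n - 1 := by
    rw [Fintype.card_subtype_compl, Fintype.card_fin, Fintype.card_subtype_eq,
      Nat.cast_sub (Nat.one_le_iff_ne_zero.2 hn), Nat.cast_one]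
  have hV' (e : Fin n) : (Nat.card {x : {x // x ≠ e} // id x = x} : ℝ) = n - 1 := by
    rw [← hV e, ← Nat.card_eq_fintype_card]
    simp
  simp only [hterm, hV, hV', Finset.sum_const, Finset.card_univ, Fintype.card_fin, nsmul_eq_mul,
    tripleCount]
  ring_nf

/-- The weight paid by an involution for each moved point. -/
noncomputable def moveWeight (n : ℕ) : ℝ := 2 ^ (-((n : ℝ) - 1) / 2)

lemma moveWeight_nonneg (n : ℕ) : 0 ≤ moveWeight n := Real.rpow_nonneg (by norm_num) _

namespace IsFAS

variable {n : ℕ} {f : Fin n → Fin n} {I : Finset (Fin n)}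

lemma card_le_rpow {T : Finset (Fin n × Fin n × Fin n)} (h : IsFAS (f, I, T)) :
    (Nat.card {T' // IsFAS (f, I, T')} : ℝ) ≤
      2 ^ (tripleCount (n - I.card) -
        (n - I.card) * (Finset.univ.filter fun x => f x ≠ x).card / 2) *
        ((2 ^ I.card - 1 : ℕ) : ℝ) ^ n := by
  have hle := h.card_le
  rw [← Nat.cast_le (α := ℝ), Nat.cast_mul, Nat.cast_pow,
    card_peirceClosed_rpow h.restrict_involutive] at hle
  refine hle.trans_eq ?_
  have hV : (Fintype.card {x // x ∉ I} : ℝ) = n - I.card := by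
    rw [Fintype.card_subtype_compl, Fintype.card_fin, Fintype.card_coe,
      Nat.cast_sub (by simpa using I.card_le_univ)]
  have hm : (Nat.card {x : {x // x ∉ I} // h.restrict x = x} : ℝ) =
      n - I.card - (Finset.univ.filter fun x => f x ≠ x).card := by
    have := h.card_fixed_add_card_moved
    rw [← Nat.cast_inj (R := ℝ)] at this
    push_cast at this
    linarith
  rw [hV, hm, tripleCount]
  congr 2
  ring

lemma card_le_of_card_eq_one (f : Fin n → Fin n) (hI : I.card = 1) :
    (Nat.card {T // IsFAS (f, I, T)} : ℝ) ≤
      2 ^ tripleCount (n - 1) * ∏ x, if f x = x then 1 else moveWeight n := by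
  rcases isEmpty_or_nonempty {T // IsFAS (f, I, T)} with hE | ⟨⟨T, h⟩⟩
  · rw [Nat.card_of_isEmpty, Nat.cast_zero]
    refine mul_nonneg (Real.rpow_nonneg (by norm_num) _) (Finset.prod_nonneg fun x _ => ?_)
    split_ifs
    exacts [zero_le_one, moveWeight_nonneg n]
  · refine h.card_le_rpow.trans_eq ?_
    rw [hI, Finset.prod_ite, Finset.prod_const_one, Finset.prod_const, one_mul, moveWeight,
      ← Real.rpow_natCast (2 ^ _), ← Real.rpow_mul (by norm_num), ← Real.rpow_add (by norm_num)]
    simp only [pow_one, Nat.add_one_sub_one, Nat.cast_one, one_pow, mul_one, ne_eq]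
    ring_nf

lemma card_le_of_two_le_card (f : Fin n → Fin n) (hI : 2 ≤ I.card)
    (hn : 2 * (n : ℝ) ≤ (n - 1) ^ 2 / 6) :
    (Nat.card {T // IsFAS (f, I, T)} : ℝ) ≤
      2 ^ tripleCount (n - 1) * 2 ^ (2 * (n : ℝ) - (n - 1) ^ 2 / 6) := by
  rcases isEmpty_or_nonempty {T // IsFAS (f, I, T)} with hE | ⟨⟨T, h⟩⟩
  · rw [Nat.card_of_isEmpty, Nat.cast_zero]
    positivity
  · refine h.card_le_rpow.trans ?_
    have hk : (I.card : ℝ) ≤ n := by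
      exact_mod_cast (by simpa using I.card_le_univ : I.card ≤ n)
    have hk2 : (2 : ℝ) ≤ I.card := by exact_mod_cast hI
    have hpow : ((2 ^ I.card - 1 : ℕ) : ℝ) ^ n ≤ 2 ^ ((I.card : ℝ) * n) := by
      rw [Real.rpow_mul (by norm_num), Real.rpow_natCast, Real.rpow_natCast]
      refine pow_le_pow_left₀ (Nat.cast_nonneg _) ?_ n
      exact_mod_cast Nat.sub_le _ _
    refine (mul_le_mul_of_nonneg_left hpow (by positivity)).trans ?_
    rw [← Real.rpow_add (by norm_num), ← Real.rpow_add (by norm_num)]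
    refine Real.rpow_le_rpow_of_exponent_le (by norm_num) ?_
    have hd : 0 ≤ ((n : ℝ) - I.card) * (Finset.univ.filter fun x => f x ≠ x).card / 2 := by
      have : 0 ≤ (n : ℝ) - I.card := by linarith
      positivity
    generalize (I.card : ℝ) = k at *
    generalize (n : ℝ) = x at *
    have hcount : tripleCount (x - k) ≤ tripleCount (x - 1) - (k - 1) * ((x - 1) ^ 2 / 6) := by
      obtain ⟨y, rfl⟩ : ∃ y, x = k + y := ⟨x - k, by ring⟩
      obtain ⟨j, rfl⟩ : ∃ j, k = j + 1 := ⟨k - 1, by ring⟩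
      have hj : 0 ≤ j := by linarith
      have hy : 0 ≤ y := by linarith
      have : 0 ≤ j * (y * (j + y) + y ^ 2 + 3 * (j + 2 * y) + 2) := by positivity
      simp only [tripleCount]
      nlinarith
    nlinarith [mul_nonneg (by linarith : (0 : ℝ) ≤ k - 2) (sub_nonneg.2 hn)]

end IsFAS

lemma card_isFAS_eq_sum (n : ℕ) : Nat.card {M : FASData n // IsFAS M} =
    ∑ f : Fin n → Fin n, ∑ I : Finset (Fin n), Nat.card {T // IsFAS (f, I, T)} := by
  let e : {M : FASData n // IsFAS M} ≃
      Σ f : Fin n → Fin n, Σ I : Finset (Fin n), {T // IsFAS (f, I, T)} :=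
    { toFun := fun M => ⟨M.1.1, M.1.2.1, M.1.2.2, M.2⟩
      invFun := fun p => ⟨(p.1, p.2.1, p.2.2.1), p.2.2.2⟩
      left_inv := fun _ => rfl
      right_inv := fun _ => rfl }
  rw [Nat.card_congr e, Nat.card_sigma]
  simp only [Nat.card_sigma]

lemma sum_prod_moveWeight (n : ℕ) :
    ∑ f : Fin n → Fin n, ∏ x, (if f x = x then 1 else moveWeight n) =
      (1 + ((n : ℝ) - 1) * moveWeight n) ^ n := by
  have h := Finset.prod_univ_sum (fun _ : Fin n => (Finset.univ : Finset (Fin n)))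
    (fun x y => if y = x then (1 : ℝ) else moveWeight n)
  rw [Fintype.piFinset_univ] at h
  rw [← h]
  have hrow (x : Fin n) : ∑ y, (if y = x then (1 : ℝ) else moveWeight n) =
      1 + ((n : ℝ) - 1) * moveWeight n := by
    rw [← Finset.add_sum_erase _ _ (Finset.mem_univ x), if_pos rfl,
      Finset.sum_congr rfl fun y hy => if_neg (Finset.ne_of_mem_erase hy), Finset.sum_const,
      Finset.card_erase_of_mem (Finset.mem_univ x), Finset.card_univ, Fintype.card_fin,
      nsmul_eq_mul, Nat.cast_sub (Nat.one_le_iff_ne_zero.2 fun h0 => by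
        subst h0; exact x.elim0), Nat.cast_one]
  simp only [hrow, Finset.prod_const, Finset.card_univ, Fintype.card_fin]

/-- The factor by which the number of FAS structures may exceed the number of symmetric
integral ones. -/
noncomputable def excess (n : ℕ) : ℝ :=
  (1 + ((n : ℝ) - 1) * moveWeight n) ^ n +
    (n : ℝ) ^ n * (2 ^ n * 2 ^ (2 * (n : ℝ) - (n - 1) ^ 2 / 6))

lemma card_isFAS_le {n : ℕ} (hn0 : n ≠ 0) (hn : 2 * (n : ℝ) ≤ (n - 1) ^ 2 / 6) :
    (Nat.card {M : FASData n // IsFAS M} : ℝ) ≤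
      n * 2 ^ tripleCount (n - 1) * excess n := by
  set X : ℝ := 2 ^ tripleCount (n - 1) with hX
  set Y : ℝ := 2 ^ (2 * (n : ℝ) - (n - 1) ^ 2 / 6) with hY
  have hX0 : 0 ≤ X := by positivity
  have hY0 : 0 ≤ Y := by positivity
  have hterm (f : Fin n → Fin n) (I : Finset (Fin n)) :
      (Nat.card {T // IsFAS (f, I, T)} : ℝ) ≤
        (if I ∈ Finset.univ.powersetCard 1
          then X * ∏ x, (if f x = x then 1 else moveWeight n) else 0) + X * Y := by
    simp only [Finset.mem_powersetCard_univ]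
    split_ifs with hI
    · exact (IsFAS.card_le_of_card_eq_one f hI).trans (le_add_of_nonneg_right (by positivity))
    · rw [zero_add]
      by_cases hI2 : 2 ≤ I.card
      · exact IsFAS.card_le_of_two_le_card f hI2 hn
      · have hI0 : I = ∅ := Finset.card_eq_zero.1 (by omega)
        have : IsEmpty {T // IsFAS (f, I, T)} :=
          ⟨fun T => (T.2.nonempty hn0).ne_empty hI0⟩
        rw [Nat.card_of_isEmpty, Nat.cast_zero]
        positivity
  rw [card_isFAS_eq_sum]
  push_cast
  refine (Finset.sum_le_sum fun f _ => Finset.sum_le_sum fun I _ => hterm f I).trans ?_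
  simp only [Finset.sum_add_distrib, Finset.sum_ite_mem, Finset.univ_inter, Finset.sum_const,
    Finset.card_powersetCard, Finset.card_univ, Fintype.card_fin, Nat.choose_one_right,
    Fintype.card_finset, Fintype.card_fun, nsmul_eq_mul, ← Finset.mul_sum, sum_prod_moveWeight]
  push_cast
  have h1 : (1 : ℝ) ≤ n := by exact_mod_cast Nat.one_le_iff_ne_zero.2 hn0
  have hZ : 0 ≤ X * ((n : ℝ) ^ n * (2 ^ n * Y)) := by positivity
  rw [excess, ← hY]
  nlinarith [mul_le_mul_of_nonneg_right h1 hZ]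

lemma tendsto_one_add_moveWeight_pow :
    Tendsto (fun n : ℕ => (1 + ((n : ℝ) - 1) * moveWeight n) ^ n) atTop (𝓝 1) := by
  have hr : |(2 : ℝ) ^ (-(1 / 2) : ℝ)| < 1 := by
    rw [abs_of_nonneg (by positivity)]
    exact Real.rpow_lt_one_of_one_lt_of_neg (by norm_num) (by norm_num)
  have hlim : Tendsto (fun n : ℕ => Real.exp ((n : ℝ) ^ 2 * moveWeight n)) atTop (𝓝 1) := by
    have h := (tendsto_pow_const_mul_const_pow_of_abs_lt_one 2 hr).mul_const ((2 : ℝ) ^ (1 / 2 : ℝ))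
    rw [zero_mul] at h
    rw [← Real.exp_zero]
    refine (Real.continuous_exp.tendsto 0).comp (h.congr fun n => ?_)
    rw [moveWeight, mul_assoc, ← Real.rpow_natCast (2 ^ _), ← Real.rpow_mul (by norm_num),
      ← Real.rpow_add (by norm_num)]
    ring_nf
  refine tendsto_of_tendsto_of_tendsto_of_le_of_le' tendsto_const_nhds hlim ?_ ?_
  · filter_upwards [eventually_ge_atTop 1] with n hn
    have h1 : 0 ≤ (n : ℝ) - 1 := sub_nonneg.2 (by exact_mod_cast hn)
    exact one_le_pow₀ (le_add_of_nonneg_right (mul_nonneg h1 (moveWeight_nonneg n)))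
  · filter_upwards [eventually_ge_atTop 1] with n hn
    have h1 : 0 ≤ (n : ℝ) - 1 := sub_nonneg.2 (by exact_mod_cast hn)
    have hw := moveWeight_nonneg n
    calc (1 + ((n : ℝ) - 1) * moveWeight n) ^ n
        ≤ Real.exp (n * moveWeight n) ^ n := by
          refine pow_le_pow_left₀ (by positivity) ?_ n
          have := Real.add_one_le_exp (n * moveWeight n)
          nlinarith
      _ = Real.exp ((n : ℝ) ^ 2 * moveWeight n) := by
          rw [← Real.exp_nat_mul]
          ring_nf

lemma tendsto_nonintegral_excess :
    Tendsto (fun n : ℕ => (n : ℝ) ^ n * (2 ^ n * 2 ^ (2 * (n : ℝ) - (n - 1) ^ 2 / 6)))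
      atTop (𝓝 0) := by
  have hr : |(2 : ℝ) ^ (-(1 / 6) : ℝ)| < 1 := by
    rw [abs_of_nonneg (by positivity)]
    exact Real.rpow_lt_one_of_one_lt_of_neg (by norm_num) (by norm_num)
  have hbase : Tendsto (fun n : ℕ => (n : ℝ) * (2 * 2 ^ (7 / 3 - (n : ℝ) / 6))) atTop (𝓝 0) := by
    have h := (tendsto_pow_const_mul_const_pow_of_abs_lt_one 1 hr).mul_const
      (2 * (2 : ℝ) ^ (7 / 3 : ℝ))
    rw [zero_mul] at h
    refine h.congr fun n => ?_
    have : (2 : ℝ) ^ (7 / 3 - (n : ℝ) / 6) = ((2 : ℝ) ^ (-(1 / 6) : ℝ)) ^ n * 2 ^ (7 / 3 : ℝ) := by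
      rw [← Real.rpow_natCast (2 ^ _), ← Real.rpow_mul (by norm_num),
        ← Real.rpow_add (by norm_num)]
      ring_nf
    rw [this]
    ring
  refine squeeze_zero' (Eventually.of_forall fun n => by positivity) ?_
    (tendsto_pow_atTop_nhds_zero_of_lt_one (r := (1 / 2 : ℝ)) (by norm_num) (by norm_num))
  filter_upwards [hbase.eventually_le_const (show (0 : ℝ) < 1 / 2 by norm_num)] with n hn
  refine le_trans ?_ (pow_le_pow_left₀ (by positivity) hn n)
  rw [mul_pow, mul_pow, ← Real.rpow_natCast (2 ^ _), ← Real.rpow_mul (by norm_num)]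
  gcongr
  · norm_num
  · linarith

lemma tendsto_excess : Tendsto excess atTop (𝓝 1) := by
  have h := tendsto_one_add_moveWeight_pow.add tendsto_nonintegral_excess
  rwa [add_zero] at h

lemma card_symmetric_integral_le (n : ℕ) :
    Nat.card {M : FASData n // IsFAS M ∧ FASSymmetric M ∧ FASIntegral M} ≤
      Nat.card {M : FASData n // IsFAS M} :=
  Nat.card_le_card_of_injective (fun M => (⟨M.1, M.2.1⟩ : {M : FASData n // IsFAS M}))
    fun _ _ h => Subtype.ext (congrArg (fun M => M.1) h)

/-- Almost all labelled FAS structures are symmetric and integral. -/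
theorem stmt0 :
    Tendsto (fun n : ℕ =>
      (Nat.card {M : FASData n // IsFAS M ∧ FASSymmetric M ∧ FASIntegral M} : ℝ) /
      (Nat.card {M : FASData n // IsFAS M} : ℝ))
      atTop (𝓝 1) := by
  have hlim : Tendsto (fun n => (excess n)⁻¹) atTop (𝓝 1) := by
    simpa using tendsto_excess.inv₀ one_ne_zero
  refine tendsto_of_tendsto_of_tendsto_of_le_of_le' hlim tendsto_const_nhds ?_ ?_
  · filter_upwards [eventually_ge_atTop 16] with n hn
    have hn0 : n ≠ 0 := by omega
    have hnR : (16 : ℝ) ≤ n := by exact_mod_cast hn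
    have hL := card_isFAS_le hn0 (by nlinarith)
    have hS := card_symmetric_integral_ge hn0
    have hA : 0 < (n : ℝ) * 2 ^ tripleCount (n - 1) := by positivity
    have hE : 0 < excess n := by
      have := moveWeight_nonneg n
      have : 0 ≤ (n : ℝ) - 1 := by linarith
      rw [excess]
      positivity
    have hLpos : 0 < (Nat.card {M : FASData n // IsFAS M} : ℝ) := by
      refine hA.trans_le (hS.trans ?_)
      exact_mod_cast card_symmetric_integral_le n
    rw [le_div_iff₀ hLpos]
    refine le_trans ?_ hS
    rw [inv_mul_le_iff₀ hE, mul_comm (excess n)]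
    exact hL
  · refine Eventually.of_forall fun n => div_le_one_of_le₀ ?_ (Nat.cast_nonneg _)
    exact_mod_cast card_symmetric_integral_le n
end

section
/- Let u_n denote the number of isomorphism classes of FAS structures with exactly n elements, and let v_n denote the number of isomorphism classes of n-element FAS structures that are symmetric and integral. Then v_n/u_n tends to 1 as n → ∞. -/
open Filter Topology

/-- Isomorphism of FAS structures: a bijection of the universe preserving
`f`, `I`, and `T` in both directions. -/
def FASIso {n : ℕ} (M N : FASData n) : Prop :=
  ∃ g : Fin n ≃ Fin n,
    (∀ x, g (M.1 x) = N.1 (g x)) ∧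
    (∀ x, x ∈ M.2.1 ↔ g x ∈ N.2.1) ∧
    (∀ a b c, (a, b, c) ∈ M.2.2 ↔ (g a, g b, g c) ∈ N.2.2)

/-- The number of isomorphism classes of `n`-element FAS structures. -/
noncomputable def uCount (n : ℕ) : ℕ :=
  Nat.card (Quot fun M N : {M : FASData n // IsFAS M} => FASIso M.1 N.1)

/-- The number of isomorphism classes of `n`-element symmetric integral FAS structures. -/
noncomputable def vCount (n : ℕ) : ℕ :=
  Nat.card
    (Quot fun M N : {M : FASData n // IsFAS M ∧ FASSymmetric M ∧ FASIntegral M} =>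
      FASIso M.1 N.1)

namespace FASCount

open Equiv

theorem quot_mk_eq_iff {G X : Type*} [Group G] (φ : G →* Perm X) (x y : X) :
    Quot.mk (fun x y : X => ∃ g, φ g x = y) x = Quot.mk _ y ↔ ∃ g, φ g x = y := by
  refine Equivalence.quot_mk_eq_iff ⟨fun x => ⟨1, by simp⟩, ?_, ?_⟩ x y
  · rintro x y ⟨g, rfl⟩
    exact ⟨g⁻¹, by rw [map_inv]; exact (φ g).symm_apply_apply x⟩
  · rintro x y z ⟨g, rfl⟩ ⟨h, rfl⟩
    exact ⟨h * g, by simp⟩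

/-- The orbit-counting lemma. -/
theorem card_quot_mul_card_group {G X : Type*} [Group G] (φ : G →* Perm X) :
    Nat.card (Quot fun x y : X => ∃ g, φ g x = y) * Nat.card G =
      Nat.card {p : G × X // φ p.1 p.2 = p.2} := by
  let _ := MulAction.compHom X φ
  rw [← Nat.card_prod]
  have e := MulAction.sigmaFixedByEquivOrbitsProdGroup G X
  have h1 : Nat.card {p : G × X // φ p.1 p.2 = p.2} = Nat.card (Σ a : G, MulAction.fixedBy X a) :=
    Nat.card_congr
      { toFun := fun p => ⟨p.1.1, p.1.2, p.2⟩
        invFun := fun p => ⟨(p.1, p.2.1), p.2.2⟩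
        left_inv := fun _ => rfl
        right_inv := fun _ => rfl }
  rw [h1, Nat.card_congr e, Nat.card_prod, Nat.card_prod]
  congr 1
  refine Nat.card_congr (Quot.congrRight fun x y => ?_)
  rw [MulAction.orbitRel_apply, MulAction.mem_orbit_symm]
  exact Iff.rfl

theorem card_quot_subtype_mul_card_group {G X : Type*} [Group G] (φ : G →* Perm X) (P : X → Prop)
    (hP : ∀ g x, P (φ g x) ↔ P x) :
    Nat.card (Quot fun x y : {x // P x} => ∃ g, φ g x = y) * Nat.card G =
      Nat.card {p : G × X // P p.2 ∧ φ p.1 p.2 = p.2} := by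
  let ψ : G →* Perm {x // P x} :=
    MonoidHom.mk' (fun g => (φ g).subtypePerm (hP g)) (fun a b => by
      ext x; simp only [map_mul]; rfl)
  have h := card_quot_mul_card_group ψ
  have h1 : Nat.card {p : G × {x // P x} // ψ p.1 p.2 = p.2} =
      Nat.card {p : G × X // P p.2 ∧ φ p.1 p.2 = p.2} :=
    Nat.card_congr
      { toFun := fun p => ⟨(p.1.1, p.1.2), p.1.2.2, congrArg Subtype.val p.2⟩
        invFun := fun p => ⟨(p.1.1, ⟨p.1.2, p.2.1⟩), Subtype.ext p.2.2⟩
        left_inv := fun _ => rfl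
        right_inv := fun _ => rfl }
  rw [← h1, ← h]
  congr 1
  exact Nat.card_congr (Quot.congrRight fun x y => by simp [ψ, Subtype.ext_iff])

/-- The sign twist: even permutations act trivially, odd ones by the involution `f`. -/
def signTwist {W : Type*} (f : Perm W) (hf : f * f = 1) : Perm (Fin 3) →* Perm W :=
  MonoidHom.mk' (fun σ => if Perm.sign σ = 1 then 1 else f) (fun σ τ => by
    rcases Int.units_eq_one_or (Perm.sign σ) with h | h <;>
    rcases Int.units_eq_one_or (Perm.sign τ) with h' | h' <;> simp [h, h', hf])

/-- The action on triples by permuting coordinates, twisted by `f` on odd permutations. -/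
def cycleHom {W : Type*} (f : Perm W) (hf : f * f = 1) :
    Perm (Fin 3) →* Perm (Fin 3 → W) :=
  MonoidHom.mk' (fun σ => Equiv.arrowCongr σ (signTwist f hf σ)) (fun σ τ => by
    ext x i; simp only [map_mul]; rfl)

/-- The orbits of triples under the twisted coordinate action. -/
abbrev CycleQuot {W : Type*} (f : Perm W) (hf : f * f = 1) :=
  Quot fun x y : Fin 3 → W => ∃ σ, cycleHom f hf σ x = y

theorem cycleHom_apply {W : Type*} (f : Perm W) (hf : f * f = 1) (σ : Perm (Fin 3))
    (x : Fin 3 → W) (i : Fin 3) :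
    cycleHom f hf σ x i = signTwist f hf σ (x (σ⁻¹ i)) := rfl

theorem fin_three_eq {i j k : Fin 3} (hij : i ≠ j) (hik : i ≠ k) (hjk : j ≠ k) (l : Fin 3) :
    l = i ∨ l = j ∨ l = k := by
  revert i j k l; decide

theorem univ_perm_fin_three : (Finset.univ : Finset (Perm (Fin 3))) =
    {1, swap 0 1, swap 0 2, swap 1 2, swap 0 1 * swap 1 2, swap 1 2 * swap 0 1} := by decide

theorem cycleHom_swap {W : Type*} (f : Perm W) (hf : f * f = 1) {i j : Fin 3} (h : i ≠ j)
   (x : Fin 3 → W) (k : Fin 3) :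
    cycleHom f hf (swap i j) x k = f (x (swap i j k)) := by
  simp [cycleHom_apply, signTwist, Perm.sign_swap h]

theorem cycleHom_of_sign_eq_one {W : Type*} (f : Perm W) (hf : f * f = 1) {σ : Perm (Fin 3)}
    (hσ : Perm.sign σ = 1) (x : Fin 3 → W) (i : Fin 3) :
    cycleHom f hf σ x i = x (σ⁻¹ i) := by
  simp [cycleHom_apply, signTwist, hσ]

theorem card_cycleQuot {W : Type*} [Fintype W] (f : Perm W) (hf : f * f = 1) :
    Nat.card (CycleQuot f hf) * 6 =
      Nat.card W ^ 3 + 3 * (Nat.card {x // f x = x} * Nat.card W) + 2 * Nat.card W := by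
  classical
  have h := card_quot_mul_card_group (cycleHom f hf)
  have hff : ∀ x, f (f x) = x := fun x => by rw [← Perm.mul_apply, hf, Perm.one_apply]
  have h6 : Nat.card (Perm (Fin 3)) = 6 := by
    rw [Nat.card_eq_fintype_card, Fintype.card_perm]; rfl
  rw [h6] at h
  rw [h]
  have e : {p : Perm (Fin 3) × (Fin 3 → W) // cycleHom f hf p.1 p.2 = p.2} ≃
      Σ σ : Perm (Fin 3), {x : Fin 3 → W // cycleHom f hf σ x = x} :=
    { toFun := fun p => ⟨p.1.1, p.1.2, p.2⟩
      invFun := fun p => ⟨(p.1, p.2.1), p.2.2⟩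
      left_inv := fun _ => rfl
      right_inv := fun _ => rfl }
  have hs : ∀ i j k : Fin 3, i ≠ j → i ≠ k → j ≠ k →
      Nat.card {x : Fin 3 → W // cycleHom f hf (swap i j) x = x} =
        Nat.card {x // f x = x} * Nat.card W := by
    intro i j k hij hik hjk
    rw [← Nat.card_prod]
    have key : ∀ x : Fin 3 → W, cycleHom f hf (swap i j) x = x ↔ x i = f (x j) ∧ f (x k) = x k := by
      intro x
      constructor
      · intro hx
        have hi := congrFun hx i
        have hk := congrFun hx k
        rw [cycleHom_swap _ _ hij] at hi hk
        rw [swap_apply_left] at hi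
        rw [swap_apply_of_ne_of_ne hik.symm hjk.symm] at hk
        exact ⟨hi.symm, hk⟩
      · rintro ⟨h1, h2⟩
        funext l
        rw [cycleHom_swap _ _ hij]
        rcases fin_three_eq hij hik hjk l with rfl | rfl | rfl
        · rw [swap_apply_left, h1]
        · rw [swap_apply_right, h1, hff]
        · rw [swap_apply_of_ne_of_ne hik.symm hjk.symm, h2]
    refine Nat.card_congr
      { toFun := fun x => (⟨x.1 k, ((key x.1).1 x.2).2⟩, x.1 j)
        invFun := fun p => ⟨fun l => if l = i then f p.2 else if l = j then p.2 else p.1.1,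
          (key _).2 (by simp [hij.symm, hik.symm, hjk.symm, p.1.2])⟩
        left_inv := ?_
        right_inv := ?_ }
    · rintro ⟨x, hx⟩
      ext l
      have hx' := (key x).1 hx
      rcases fin_three_eq hij hik hjk l with rfl | rfl | rfl
      · simp [hx'.1]
      · simp [hij.symm]
      · simp [hik.symm, hjk.symm]
    · rintro ⟨⟨x, hx⟩, y⟩
      simp [hij.symm, hik.symm, hjk.symm]
  have hc : ∀ σ : Perm (Fin 3), (σ = swap 0 1 * swap 1 2 ∨ σ = swap 1 2 * swap 0 1) →
      Nat.card {x : Fin 3 → W // cycleHom f hf σ x = x} = Nat.card W := by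
    intro σ hσ
    have hsg : Perm.sign σ = 1 := by rcases hσ with rfl | rfl <;> decide
    have happ := cycleHom_of_sign_eq_one f hf hsg
    have key : ∀ x : Fin 3 → W, cycleHom f hf σ x = x → ∀ l, x l = x 0 := by
      intro x hx l
      have h' : ∀ i, x (σ⁻¹ i) = x i := fun i => (happ x i).symm.trans (congrFun hx i)
      have a0 := h' 0
      have a1 := h' 1
      have a2 := h' 2
      rcases hσ with rfl | rfl
      · rw [show (swap 0 1 * swap 1 2 : Perm (Fin 3))⁻¹ 0 = 2 by decide] at a0
        rw [show (swap 0 1 * swap 1 2 : Perm (Fin 3))⁻¹ 1 = 0 by decide] at a1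
        fin_cases l
        · rfl
        · exact a1.symm
        · exact a0
      · rw [show (swap 1 2 * swap 0 1 : Perm (Fin 3))⁻¹ 0 = 1 by decide] at a0
        rw [show (swap 1 2 * swap 0 1 : Perm (Fin 3))⁻¹ 2 = 0 by decide] at a2
        fin_cases l
        · rfl
        · exact a0
        · exact a2.symm
    exact Nat.card_congr
      { toFun := fun x => x.1 0
        invFun := fun w => ⟨fun _ => w, by funext i; rw [happ]⟩
        left_inv := fun x => by ext l; exact (key x.1 x.2 l).symm
        right_inv := fun _ => rfl }
  have h1 : Nat.card {x : Fin 3 → W // cycleHom f hf 1 x = x} = Nat.card W ^ 3 := by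
    simp
  rw [Nat.card_congr e, Nat.card_sigma, univ_perm_fin_three]
  rw [Finset.sum_insert (by decide), Finset.sum_insert (by decide), Finset.sum_insert (by decide),
    Finset.sum_insert (by decide), Finset.sum_insert (by decide), Finset.sum_singleton, h1,
    hs 0 1 2 (by decide) (by decide) (by decide), hs 0 2 1 (by decide) (by decide) (by decide),
    hs 1 2 0 (by decide) (by decide) (by decide), hc _ (Or.inl rfl), hc _ (Or.inr rfl)]
  ring

/-- Transport of structure along a permutation of the universe. -/
def transport (n : ℕ) : Perm (Fin n) →* Perm (FASData n) :=
  MonoidHom.mk' (fun g => (Equiv.arrowCongr g g).prodCongr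
      (g.finsetCongr.prodCongr (g.prodCongr (g.prodCongr g)).finsetCongr)) (fun g h => by
    ext M x
    · rfl
    · simp [Finset.mem_map_equiv]; rfl
    · simp [Finset.mem_map_equiv]; rfl)

theorem transport_eq_iff {n : ℕ} (g : Perm (Fin n)) (M N : FASData n) :
    transport n g M = N ↔ (∀ x, g (M.1 x) = N.1 (g x)) ∧ (∀ x, x ∈ M.2.1 ↔ g x ∈ N.2.1) ∧
      (∀ a b c, (a, b, c) ∈ M.2.2 ↔ (g a, g b, g c) ∈ N.2.2) := by
  have h : transport n g M = (g ∘ M.1 ∘ g.symm, M.2.1.map g.toEmbedding,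
    M.2.2.map (g.prodCongr (g.prodCongr g)).toEmbedding) := rfl
  rw [h]
  obtain ⟨f, I, T⟩ := N
  simp only [Prod.mk.injEq]
  refine and_congr ?_ (and_congr ?_ ?_)
  · constructor
    · rintro rfl x
      simp
    · intro h
      funext x
      simp [h]
  · constructor
    · rintro rfl x
      simp
    · intro h
      ext x
      simp [Finset.mem_map_equiv, h]
  · constructor
    · rintro rfl a b c
      simp [Finset.mem_map_equiv]
    · intro h
      ext ⟨a, b, c⟩
      simp [Finset.mem_map_equiv, h]

theorem fasIso_iff {n : ℕ} (M N : FASData n) : FASIso M N ↔ ∃ g, transport n g M = N := by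
  simp only [transport_eq_iff]; rfl

theorem isFAS_of_transport {n : ℕ} {g : Perm (Fin n)} {M N : FASData n} (h : transport n g M = N)
    (hM : IsFAS M) : IsFAS N := by
  obtain ⟨hf, hI, hT⟩ := (transport_eq_iff g M N).1 h
  refine ⟨fun a b c habc => ?_, fun a b => ?_⟩
  · obtain ⟨a, rfl⟩ := g.surjective a
    obtain ⟨b, rfl⟩ := g.surjective b
    obtain ⟨c, rfl⟩ := g.surjective c
    rw [← hf, ← hf, ← hT, ← hT]
    exact hM.1 a b c ((hT a b c).2 habc)
  · obtain ⟨a, rfl⟩ := g.surjective a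
    obtain ⟨b, rfl⟩ := g.surjective b
    rw [g.injective.eq_iff, hM.2 a b]
    constructor
    · rintro ⟨i, hi, hi'⟩
      exact ⟨g i, (hI i).1 hi, (hT _ _ _).1 hi'⟩
    · rintro ⟨i, hi, hi'⟩
      obtain ⟨i, rfl⟩ := g.surjective i
      exact ⟨i, (hI i).2 hi, (hT _ _ _).2 hi'⟩

theorem isFAS_transport_iff {n : ℕ} (g : Perm (Fin n)) (M : FASData n) :
    IsFAS (transport n g M) ↔ IsFAS M :=
  ⟨isFAS_of_transport (g := g⁻¹) (by rw [map_inv]; exact (transport n g).symm_apply_apply M),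
    isFAS_of_transport rfl⟩

theorem symmetric_integral_of_transport {n : ℕ} {g : Perm (Fin n)} {M N : FASData n}
    (h : transport n g M = N) (hM : FASSymmetric M ∧ FASIntegral M) :
    FASSymmetric N ∧ FASIntegral N := by
  have h1 : N.2.1 = M.2.1.map g.toEmbedding := h ▸ rfl
  refine ⟨fun x => ?_, ?_⟩
  · obtain ⟨x, rfl⟩ := g.surjective x
    rw [← ((transport_eq_iff g M N).1 h).1, hM.1]
  · rw [FASIntegral, h1, Finset.card_map]
    exact hM.2

theorem symmetric_integral_transport_iff {n : ℕ} (g : Perm (Fin n)) (M : FASData n) :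
    (FASSymmetric (transport n g M) ∧ FASIntegral (transport n g M)) ↔
      (FASSymmetric M ∧ FASIntegral M) :=
  ⟨symmetric_integral_of_transport (g := g⁻¹) (by rw [map_inv]; exact (transport n g).symm_apply_apply M),
    symmetric_integral_of_transport rfl⟩

/-- The pairs of an automorphism and a structure that is not both symmetric and integral. -/
abbrev AtypicalFixed (n : ℕ) :=
  {p : Perm (Fin n) × FASData n //
    (IsFAS p.2 ∧ ¬ (FASSymmetric p.2 ∧ FASIntegral p.2)) ∧ transport n p.1 p.2 = p.2}

theorem uCount_mul_factorial (n : ℕ) :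
    uCount n * n.factorial = vCount n * n.factorial + Nat.card (AtypicalFixed n) := by
  classical
  have hn : Nat.card (Perm (Fin n)) = n.factorial := by
    rw [Nat.card_eq_fintype_card, Fintype.card_perm, Fintype.card_fin]
  have hu := card_quot_subtype_mul_card_group (transport n) IsFAS isFAS_transport_iff
  have hv := card_quot_subtype_mul_card_group (transport n)
    (fun M => IsFAS M ∧ FASSymmetric M ∧ FASIntegral M)
    (fun g M => and_congr (isFAS_transport_iff g M) (symmetric_integral_transport_iff g M))
  simp only [← fasIso_iff, hn] at hu hv
  rw [uCount, vCount, hu, hv]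
  simp only [Nat.card_eq_fintype_card, Fintype.card_subtype]
  rw [← Finset.card_filter_add_card_filter_not
    (p := fun p : Perm (Fin n) × FASData n => FASSymmetric p.2 ∧ FASIntegral p.2)]
  simp only [Finset.filter_filter]
  congr 2 <;> ext <;> simp <;> tauto

theorem card_typical_le_vCount_mul_factorial (n : ℕ) :
    Nat.card {M : FASData n // IsFAS M ∧ FASSymmetric M ∧ FASIntegral M} ≤
      vCount n * n.factorial := by
  have hn : Nat.card (Perm (Fin n)) = n.factorial := by
    rw [Nat.card_eq_fintype_card, Fintype.card_perm, Fintype.card_fin]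
  have hv := card_quot_subtype_mul_card_group (transport n)
    (fun M => IsFAS M ∧ FASSymmetric M ∧ FASIntegral M)
    (fun g M => and_congr (isFAS_transport_iff g M) (symmetric_integral_transport_iff g M))
  simp only [← fasIso_iff, hn] at hv
  rw [vCount, hv]
  refine Nat.card_le_card_of_injective (fun M => ⟨(1, M.1), M.2, by simp⟩) ?_
  intro M N h
  simpa [Subtype.ext_iff] using h

section Structure

variable {n : ℕ} {f : Fin n → Fin n} {I : Finset (Fin n)} {T : Finset (Fin n × Fin n × Fin n)}

theorem eq_of_mem_of_mem (h : IsFAS (f, I, T)) {a i b : Fin n} (hi : i ∈ I)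
    (hT : (a, i, b) ∈ T) : a = b :=
  (h.2 a b).2 ⟨i, hi, hT⟩

theorem involutive (h : IsFAS (f, I, T)) : Function.Involutive f := by
  intro a
  obtain ⟨i, hi, hT⟩ := (h.2 a a).1 rfl
  exact eq_of_mem_of_mem h hi (h.1 _ _ _ (h.1 _ _ _ hT).1).1

theorem mem_iff_left (h : IsFAS (f, I, T)) (a b c : Fin n) :
    (a, b, c) ∈ T ↔ (f a, c, b) ∈ T :=
  ⟨fun hT => (h.1 _ _ _ hT).1, fun hT => by
    simpa [involutive h a] using (h.1 _ _ _ hT).1⟩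

theorem mem_iff_right (h : IsFAS (f, I, T)) (a b c : Fin n) :
    (a, b, c) ∈ T ↔ (c, f b, a) ∈ T :=
  ⟨fun hT => (h.1 _ _ _ hT).2, fun hT => by
    simpa [involutive h b] using (h.1 _ _ _ hT).2⟩

theorem diagonal_mem (h : IsFAS (f, I, T)) {i : Fin n} (hi : i ∈ I) : (i, i, i) ∈ T := by
  obtain ⟨j, hj, hT⟩ := (h.2 i i).1 rfl
  have h1 : f i = j := eq_of_mem_of_mem h hi ((mem_iff_left h _ _ _).1 hT)
  have h2 := (mem_iff_right h _ _ _).1 hT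
  rwa [← h1, involutive h i] at h2

theorem fixed_of_mem (h : IsFAS (f, I, T)) {i : Fin n} (hi : i ∈ I) : f i = i :=
  eq_of_mem_of_mem h hi ((mem_iff_left h _ _ _).1 (diagonal_mem h hi))

theorem eq_of_mem_identities (h : IsFAS (f, I, T)) {i j : Fin n} (hi : i ∈ I)
    (hT : (i, j, i) ∈ T) : i = j := by
  rw [← eq_of_mem_of_mem h hi ((mem_iff_left h _ _ _).1 hT), fixed_of_mem h hi]

theorem map_mem_iff (h : IsFAS (f, I, T)) (x : Fin n) : f x ∉ I ↔ x ∉ I := by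
  refine not_congr ⟨fun hx => ?_, fun hx => ?_⟩
  · have := fixed_of_mem h hx
    rw [involutive h x] at this
    rwa [this]
  · rwa [fixed_of_mem h hx]

theorem mem_iff_middle (h : IsFAS (f, I, T)) (a b c : Fin n) :
    (a, b, c) ∈ T ↔ (f b, f a, f c) ∈ T := by
  rw [mem_iff_left h, mem_iff_right h, mem_iff_left h]

/-- A structure is determined by `f`, `I`, the identities of its non-identity elements, and its
triples of non-identity elements. -/
theorem relation_ext {T' : Finset (Fin n × Fin n × Fin n)} (h : IsFAS (f, I, T))
    (h' : IsFAS (f, I, T')) (hD : ∀ i ∈ I, ∀ a ∉ I, (a, i, a) ∈ T ↔ (a, i, a) ∈ T')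
    (hW : ∀ a ∉ I, ∀ b ∉ I, ∀ c ∉ I, (a, b, c) ∈ T ↔ (a, b, c) ∈ T') : T = T' := by
  have hmid : ∀ a b c, b ∈ I → ((a, b, c) ∈ T ↔ (a, b, c) ∈ T') := by
    intro a b c hb
    by_cases hac : a = c
    · subst hac
      by_cases ha : a ∈ I
      · constructor
        · intro hT
          rw [← eq_of_mem_identities h ha hT]
          exact diagonal_mem h' ha
        · intro hT
          rw [← eq_of_mem_identities h' ha hT]
          exact diagonal_mem h ha
      · exact hD b hb a ha
    · exact iff_of_false (fun hT => hac (eq_of_mem_of_mem h hb hT))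
        (fun hT => hac (eq_of_mem_of_mem h' hb hT))
  have hfst : ∀ a b c, a ∈ I → ((a, b, c) ∈ T ↔ (a, b, c) ∈ T') := by
    intro a b c ha
    rw [mem_iff_middle h, mem_iff_middle h']
    exact hmid _ _ _ (by rwa [fixed_of_mem h ha])
  ext ⟨a, b, c⟩
  by_cases ha : a ∈ I
  · exact hfst _ _ _ ha
  by_cases hb : b ∈ I
  · exact hmid _ _ _ hb
  by_cases hc : c ∈ I
  · rw [mem_iff_right h, mem_iff_right h']
    exact hfst _ _ _ hc
  · exact hW a ha b hb c hc

end Structure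

section Counting

variable {n : ℕ} {f : Fin n → Fin n} {I : Finset (Fin n)}

/-- The permutation induced by `f` on the non-identity elements. -/
def coreperm (hf : Function.Involutive f) (hI : ∀ x, f x ∉ I ↔ x ∉ I) : Perm {x // x ∉ I} :=
  (hf.toPerm f).subtypePerm hI

theorem coreperm_apply (hf : Function.Involutive f) (hI : ∀ x, f x ∉ I ↔ x ∉ I)
    (x : {x // x ∉ I}) : (coreperm hf hI x : Fin n) = f x := rfl

theorem coreperm_mul_self (hf : Function.Involutive f) (hI : ∀ x, f x ∉ I ↔ x ∉ I) :
    coreperm hf hI * coreperm hf hI = 1 := by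
  ext x
  simp [coreperm_apply, hf x.1]

/-- The triples of non-identity elements of `T`, with the last coordinate twisted by `f` so that
the closure conditions become invariance under `cycleHom`. -/
def coreTriples (f : Fin n → Fin n) (I : Finset (Fin n)) (T : Finset (Fin n × Fin n × Fin n)) :
    Set (Fin 3 → {x // x ∉ I}) :=
  {x | ((x 0 : Fin n), (x 1 : Fin n), f (x 2)) ∈ T}

theorem cycleHom_mem_coreTriples (hf : Function.Involutive f) (hI : ∀ x, f x ∉ I ↔ x ∉ I)
    {T : Finset (Fin n × Fin n × Fin n)} (h : IsFAS (f, I, T)) (σ : Perm (Fin 3))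
    (x : Fin 3 → {x // x ∉ I}) :
    cycleHom (coreperm hf hI) (coreperm_mul_self hf hI) σ x ∈ coreTriples f I T ↔
      x ∈ coreTriples f I T := by
  induction σ using Perm.swap_induction_on with
  | one => simp
  | swap_mul σ i j hij ih =>
    rw [map_mul, Perm.mul_apply, ← ih]
    generalize cycleHom (coreperm hf hI) (coreperm_mul_self hf hI) σ x = y
    have h01 := mem_iff_middle h (y 0) (y 1) (f (y 2))
    have h02 := mem_iff_right h (y 0) (y 1) (f (y 2))
    have h12 := mem_iff_left h (y 0) (y 1) (f (y 2))
    simp only [coreTriples, Set.mem_ofPred_eq, cycleHom_swap _ _ hij, coreperm_apply]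
    have key : (i = 0 ∧ j = 1 ∨ i = 1 ∧ j = 0) ∨ (i = 0 ∧ j = 2 ∨ i = 2 ∧ j = 0) ∨
        (i = 1 ∧ j = 2 ∨ i = 2 ∧ j = 1) := by
      clear * - hij
      revert i j; decide
    rcases key with key | key | key
    · have : swap i j = swap 0 1 := by
        rcases key with ⟨rfl, rfl⟩ | ⟨rfl, rfl⟩ <;> decide
      rw [this, h01]
      rfl
    · have : swap i j = swap 0 2 := by
        rcases key with ⟨rfl, rfl⟩ | ⟨rfl, rfl⟩ <;> decide
      rw [this, h02, show swap (0 : Fin 3) 2 0 = 2 by decide, show swap (0 : Fin 3) 2 1 = 1 by decide,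
        show swap (0 : Fin 3) 2 2 = 0 by decide, hf]
    · have : swap i j = swap 1 2 := by
        rcases key with ⟨rfl, rfl⟩ | ⟨rfl, rfl⟩ <;> decide
      rw [this, h12, show swap (1 : Fin 3) 2 0 = 0 by decide,
        show swap (1 : Fin 3) 2 1 = 2 by decide, show swap (1 : Fin 3) 2 2 = 1 by decide, hf]

/-- An upper bound for the number of relations compatible with `f` and `I`: outside the set `E` the
identities are forced, and on the set `S` of cycles membership is determined by the other cycles. -/
theorem card_relations_le (hf : Function.Involutive f) (hI : ∀ x, f x ∉ I ↔ x ∉ I)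
    (𝒯 : Set (Finset (Fin n × Fin n × Fin n))) (h𝒯 : ∀ T ∈ 𝒯, IsFAS (f, I, T))
    (E : Set ({x // x ∈ I} × {x // x ∉ I}))
    (hE : ∀ p ∉ E, ∀ T ∈ 𝒯, ((p.2 : Fin n), (p.1 : Fin n), (p.2 : Fin n)) ∈ T)
    (S : Set (CycleQuot (coreperm hf hI) (coreperm_mul_self hf hI)))
    (hS : ∀ x, Quot.mk _ x ∈ S → ∃ y, Quot.mk _ y ∉ S ∧
      ∀ T ∈ 𝒯, (x ∈ coreTriples f I T ↔ y ∈ coreTriples f I T)) :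
    Nat.card 𝒯 ≤ 2 ^ Nat.card E *
      2 ^ (Nat.card (CycleQuot (coreperm hf hI) (coreperm_mul_self hf hI)) - Nat.card S) := by
  classical
  have hcard : ∀ (α : Type) [Finite α], Nat.card (Set α) = 2 ^ Nat.card α := by
    intro α _
    have := Fintype.ofFinite α
    rw [Nat.card_eq_fintype_card, Nat.card_eq_fintype_card, Fintype.card_set]
  have hSc : Nat.card (CycleQuot (coreperm hf hI) (coreperm_mul_self hf hI)) - Nat.card S =
      Nat.card ↥Sᶜ := by
    have := Set.ncard_add_ncard_compl S
    simp only [Nat.card_coe_set_eq]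
    omega
  rw [hSc, ← hcard, ← hcard, ← Nat.card_prod]
  refine Nat.card_le_card_of_injective (fun T : 𝒯 =>
    (({p | ((p.1.2 : Fin n), (p.1.1 : Fin n), (p.1.2 : Fin n)) ∈ T.1} : Set E),
      ({q | ∃ x ∈ coreTriples f I T.1, Quot.mk _ x = q.1} : Set ↥Sᶜ))) ?_
  rintro ⟨T, hT⟩ ⟨T', hT'⟩ heq
  simp only [Prod.mk.injEq] at heq
  obtain ⟨h1, h2⟩ := heq
  have hmk : ∀ T ∈ 𝒯, ∀ x, x ∈ coreTriples f I T ↔ ∃ y ∈ coreTriples f I T,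
      (Quot.mk _ y : CycleQuot (coreperm hf hI) (coreperm_mul_self hf hI)) = Quot.mk _ x := by
    intro T hT x
    refine ⟨fun hx => ⟨x, hx, rfl⟩, ?_⟩
    rintro ⟨y, hy, hyx⟩
    obtain ⟨σ, rfl⟩ := (quot_mk_eq_iff _ _ _).1 hyx
    exact (cycleHom_mem_coreTriples hf hI (h𝒯 T hT) σ y).2 hy
  have hout : ∀ x, (Quot.mk _ x : CycleQuot (coreperm hf hI) (coreperm_mul_self hf hI)) ∉ S →
      (x ∈ coreTriples f I T ↔ x ∈ coreTriples f I T') := by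
    intro x hx
    rw [hmk T hT, hmk T' hT']
    exact Set.ext_iff.1 h2 ⟨Quot.mk _ x, hx⟩
  have hall : ∀ x, x ∈ coreTriples f I T ↔ x ∈ coreTriples f I T' := by
    intro x
    by_cases hx : (Quot.mk _ x : CycleQuot (coreperm hf hI) (coreperm_mul_self hf hI)) ∈ S
    · obtain ⟨y, hy, hxy⟩ := hS x hx
      rw [hxy T hT, hxy T' hT', hout y hy]
    · exact hout x hx
  refine Subtype.ext (relation_ext (h𝒯 T hT) (h𝒯 T' hT') (fun i hi a ha => ?_)
    (fun a ha b hb c hc => ?_))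
  · by_cases hp : ((⟨i, hi⟩, ⟨a, ha⟩) : {x // x ∈ I} × {x // x ∉ I}) ∈ E
    · exact Set.ext_iff.1 h1 ⟨_, hp⟩
    · exact iff_of_true (hE _ hp T hT) (hE _ hp T' hT')
  · have := hall ![⟨a, ha⟩, ⟨b, hb⟩, ⟨f c, (hI c).2 hc⟩]
    simpa [coreTriples, hf c] using this

end Counting

/-- A nontrivial permutation moves quadratically many cycles off themselves. -/
theorem exists_cycles_moved {W : Type*} [Fintype W] (f : Perm W) (hf : f * f = 1) (g : Perm W)
    {x : W} (hx : g x ≠ x) {p : ℕ} (hp : 2 * p + 2 ≤ Fintype.card W) :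
    ∃ S : Set (CycleQuot f hf), p * p ≤ 6 * Nat.card S ∧
      ∀ q ∈ S, ∃ y, Quot.mk _ y = q ∧ Quot.mk _ (g ∘ y) ∉ S := by
  classical
  have hff : ∀ x, f (f x) = x := fun x => by rw [← Perm.mul_apply, hf, Perm.one_apply]
  have hpair : ({g x, f (g x)} : Finset W).card ≤ 2 := Finset.card_le_two
  obtain ⟨B, hB, hBc⟩ : ∃ B ⊆ ({g x, f (g x)} : Finset W)ᶜ, B.card = p := by
    apply Finset.exists_subset_card_eq
    rw [Finset.card_compl]
    omega
  obtain ⟨Z, hZ, hZc⟩ : ∃ Z ⊆ (({g x, f (g x)} : Finset W) ∪ B.image (fun b => f (g b)))ᶜ,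
      Z.card = p := by
    apply Finset.exists_subset_card_eq
    rw [Finset.card_compl]
    have h1 := Finset.card_union_le ({g x, f (g x)} : Finset W) (B.image (fun b => f (g b)))
    have h2 : (B.image (fun b => f (g b))).card ≤ B.card := Finset.card_image_le
    omega
  let r : W × W → CycleQuot f hf := fun c => Quot.mk _ ![x, c.1, c.2]
  refine ⟨((B ×ˢ Z).image r : Finset _), ?_, ?_⟩
  · have hcard : (B ×ˢ Z).card = p * p := by rw [Finset.card_product, hBc, hZc]
    rw [Nat.card_coe_set_eq, Set.ncard_coe_finset, ← hcard]
    refine Finset.card_le_mul_card_image _ _ fun q hq => ?_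
    obtain ⟨c, _, rfl⟩ := Finset.mem_image.1 hq
    have h6 : (Finset.univ : Finset (Perm (Fin 3))).card = 6 := by
      rw [Finset.card_univ, Fintype.card_perm]; rfl
    rw [← h6]
    refine (Finset.card_le_card (t := Finset.univ.image fun σ : Perm (Fin 3) =>
      (cycleHom f hf σ ![x, c.1, c.2] 1, cycleHom f hf σ ![x, c.1, c.2] 2)) ?_).trans
      Finset.card_image_le
    intro d hd
    obtain ⟨σ, hσ⟩ := (quot_mk_eq_iff _ _ _).1 (Finset.mem_filter.1 hd).2.symm
    exact Finset.mem_image.2 ⟨σ, Finset.mem_univ _, by rw [hσ]; rfl⟩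
  · intro q hq
    obtain ⟨⟨b, z⟩, hbz, rfl⟩ := Finset.mem_image.1 (Finset.mem_coe.1 hq)
    refine ⟨_, rfl, fun hmem => ?_⟩
    obtain ⟨⟨b', z'⟩, hbz', hr⟩ := Finset.mem_image.1 (Finset.mem_coe.1 hmem)
    obtain ⟨σ, hσ⟩ := (quot_mk_eq_iff _ _ _).1 hr
    have hb := (Finset.mem_product.1 hbz).1
    have hb' := hB (Finset.mem_product.1 hbz').1
    have hz' := hZ (Finset.mem_product.1 hbz').2
    simp only [Finset.mem_compl, Finset.mem_insert, Finset.mem_singleton, not_or,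
      Finset.mem_union, Finset.mem_image, not_exists, not_and] at hb' hz'
    have e0 := congrFun hσ 0
    have e1 := congrFun hσ 1
    have hmem := Finset.mem_univ σ
    simp only [univ_perm_fin_three, Finset.mem_insert, Finset.mem_singleton] at hmem
    rcases hmem with rfl | rfl | rfl | rfl | rfl | rfl
    · exact hx (by simpa using e0.symm)
    · rw [cycleHom_swap _ _ (by decide)] at e0
      exact hb'.2 (by simpa [hff] using congrArg f e0)
    · rw [cycleHom_swap _ _ (by decide)] at e0
      exact hz'.1.2 (by simpa [hff] using congrArg f e0)
    · rw [cycleHom_swap _ _ (by decide)] at e1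
      exact hz'.2 b hb (by simpa [hff] using (congrArg f e1).symm)
    · rw [cycleHom_of_sign_eq_one _ _ (by decide),
        show (swap 0 1 * swap 1 2 : Perm (Fin 3))⁻¹ 0 = 2 by decide] at e0
      exact hz'.1.1 e0
    · rw [cycleHom_of_sign_eq_one _ _ (by decide),
        show (swap 1 2 * swap 0 1 : Perm (Fin 3))⁻¹ 0 = 1 by decide] at e0
      exact hb'.1 e0

theorem six_mul_choose (m : ℕ) : (m + 2).choose 3 * 6 = m ^ 3 + 3 * (m * m) + 2 * m := by
  have h := Nat.descFactorial_eq_factorial_mul_choose (m + 2) 3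
  have h3 : (m + 2).descFactorial 3 = (m + 2) * ((m + 1) * m) := by
    simp [Nat.descFactorial]; ring
  rw [h3, show Nat.factorial 3 = 6 by rfl] at h
  linarith [h, show (m + 2) * ((m + 1) * m) = m ^ 3 + 3 * (m * m) + 2 * m by ring]

section Bounds

variable {n : ℕ} {f : Fin n → Fin n} {I : Finset (Fin n)}

theorem card_core (I : Finset (Fin n)) : Nat.card {x // x ∉ I} = n - I.card := by
  rw [Nat.card_eq_fintype_card, Fintype.card_subtype_compl, Fintype.card_fin, Fintype.card_coe]

theorem card_cycleQuot_le (hf : Function.Involutive f) (hI : ∀ x, f x ∉ I ↔ x ∉ I) :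
    Nat.card (CycleQuot (coreperm hf hI) (coreperm_mul_self hf hI)) ≤
      (n - I.card + 2).choose 3 := by
  have h1 := card_cycleQuot (coreperm hf hI) (coreperm_mul_self hf hI)
  have h2 := six_mul_choose (n - I.card)
  have h3 : Nat.card {x // coreperm hf hI x = x} ≤ n - I.card :=
    card_core I ▸ Nat.card_le_card_of_injective _ Subtype.val_injective
  rw [card_core] at h1
  have := Nat.mul_le_mul_right (n - I.card) h3
  omega

theorem card_relations_le_general (hf : Function.Involutive f) (hI : ∀ x, f x ∉ I ↔ x ∉ I) :
    Nat.card {T | IsFAS (f, I, T)} ≤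
      2 ^ (I.card * (n - I.card) + (n - I.card + 2).choose 3) := by
  have h := card_relations_le hf hI {T | IsFAS (f, I, T)} (fun T hT => hT) Set.univ
    (fun p hp => absurd trivial hp) ∅ (fun x hx => absurd hx (Set.notMem_empty _))
  refine h.trans ?_
  rw [pow_add]
  refine Nat.mul_le_mul (Nat.pow_le_pow_right two_pos ?_) (Nat.pow_le_pow_right two_pos ?_)
  · rw [Nat.card_coe_set_eq, Set.ncard_univ, Nat.card_prod, card_core]
    simp
  · exact (Nat.sub_le _ _).trans (card_cycleQuot_le hf hI)

theorem identity_mem_of_card_eq_one {T : Finset (Fin n × Fin n × Fin n)} (h : IsFAS (f, I, T))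
    (h1 : I.card = 1) {i : Fin n} (hi : i ∈ I) (a : Fin n) : (a, i, a) ∈ T := by
  obtain ⟨j, hj, hT⟩ := (h.2 a a).1 rfl
  rwa [Finset.card_le_one.1 h1.le i hi j hj]

theorem card_relations_le_integral (hf : Function.Involutive f) (hI : ∀ x, f x ∉ I ↔ x ∉ I)
    (h1 : I.card = 1) : Nat.card {T | IsFAS (f, I, T)} ≤
      2 ^ Nat.card (CycleQuot (coreperm hf hI) (coreperm_mul_self hf hI)) := by
  have h := card_relations_le hf hI {T | IsFAS (f, I, T)} (fun T hT => hT) ∅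
    (fun p _ T hT => identity_mem_of_card_eq_one hT h1 p.1.2 _) ∅
    (fun x hx => absurd hx (Set.notMem_empty _))
  simpa using h

theorem two_mul_card_cycleQuot_add (hf : Function.Involutive f) (hI : ∀ x, f x ∉ I ↔ x ∉ I)
    (h1 : I.card = 1) (hfix : ∀ i ∈ I, f i = i) :
    2 * Nat.card (CycleQuot (coreperm hf hI) (coreperm_mul_self hf hI)) +
      (Finset.univ.filter fun x => f x ≠ x).card * (n - 1) = 2 * (n + 1).choose 3 := by
  obtain ⟨e, rfl⟩ := Finset.card_eq_one.1 h1
  have hn : n - 1 + 2 = n + 1 := by have := e.pos; omega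
  have h2 := card_cycleQuot (coreperm hf hI) (coreperm_mul_self hf hI)
  have h3 := six_mul_choose (n - 1)
  rw [card_core, Finset.card_singleton] at h2
  rw [hn] at h3
  have h4 : Nat.card {x // coreperm hf hI x = x} + (Finset.univ.filter fun x => f x ≠ x).card =
      n - 1 := by
    have h5 : (Finset.univ.filter fun x => f x ≠ x).card =
        Nat.card {x // ¬ coreperm hf hI x = x} := by
      rw [← Fintype.card_subtype, ← Nat.card_eq_fintype_card]
      exact Nat.card_congr
        { toFun := fun x => ⟨⟨x.1, fun hx => x.2 (hfix _ hx)⟩,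
            fun hx => x.2 (congrArg Subtype.val hx)⟩
          invFun := fun x => ⟨x.1.1, fun hx => x.2 (Subtype.ext hx)⟩
          left_inv := fun _ => rfl
          right_inv := fun _ => rfl }
    have h6 := card_core {e}
    rw [Finset.card_singleton] at h6
    classical
    rw [h5, ← h6, ← Nat.card_sum]
    exact Nat.card_congr (Equiv.sumCompl _)
  generalize Nat.card {x // coreperm hf hI x = x} = s at *
  generalize (Finset.univ.filter fun x => f x ≠ x).card = r at *
  generalize Nat.card (CycleQuot (coreperm hf hI) (coreperm_mul_self hf hI)) = c at *
  generalize n - 1 = m at *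
  subst h4
  nlinarith

theorem card_fixed_relations_le (hf : Function.Involutive f) (hI : ∀ x, f x ∉ I ↔ x ∉ I)
    (h1 : I.card = 1) {g : Perm (Fin n)} (hg : g ≠ 1) (hn : 3 ≤ n) :
    Nat.card {T | IsFAS (f, I, T) ∧ transport n g (f, I, T) = (f, I, T)} ≤
      2 ^ ((n + 1).choose 3 - (n - 3) / 2 * ((n - 3) / 2) / 6) := by
  classical
  by_cases hne : Nonempty {T | IsFAS (f, I, T) ∧ transport n g (f, I, T) = (f, I, T)}
  swap
  · rw [not_nonempty_iff] at hne
    simp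
  obtain ⟨T₀, hT₀, haut⟩ := hne
  obtain ⟨hgf, hgI, -⟩ := (transport_eq_iff _ _ _).1 haut
  let g' : Perm {x // x ∉ I} := g.subtypePerm fun x => not_congr (hgI x).symm
  obtain ⟨x, hx⟩ : ∃ x, g' x ≠ x := by
    by_contra! hall
    apply hg
    obtain ⟨e, rfl⟩ := Finset.card_eq_one.1 h1
    ext y
    by_cases hy : y ∈ ({e} : Finset (Fin n))
    · have := (hgI y).1 hy
      rw [Finset.mem_singleton] at hy this
      rw [this, hy]; rfl
    · have := congrArg Subtype.val (hall ⟨y, hy⟩)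
      exact congrArg Fin.val this
  obtain ⟨S, hS, hmov⟩ := exists_cycles_moved (coreperm hf hI) (coreperm_mul_self hf hI) g' hx
    (p := (n - 3) / 2) (by rw [← Nat.card_eq_fintype_card, card_core, h1]; omega)
  have h := card_relations_le hf hI
    {T | IsFAS (f, I, T) ∧ transport n g (f, I, T) = (f, I, T)} (fun T hT => hT.1) ∅
    (fun p _ T hT => identity_mem_of_card_eq_one hT.1 h1 p.1.2 _) S (by
      intro x hx
      obtain ⟨y, hy, hyS⟩ := hmov _ hx
      refine ⟨_, hyS, fun T hT => ?_⟩
      obtain ⟨σ, rfl⟩ := (quot_mk_eq_iff _ _ _).1 hy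
      rw [cycleHom_mem_coreTriples hf hI hT.1]
      have := ((transport_eq_iff _ _ _).1 hT.2).2.2 (y 0) (y 1) (f (y 2))
      rw [hgf] at this
      exact this)
  refine h.trans ?_
  rw [Nat.card_coe_set_eq, Set.ncard_empty, pow_zero, one_mul]
  refine Nat.pow_le_pow_right two_pos ?_
  have hc := card_cycleQuot_le hf hI
  rw [h1, show n - 1 + 2 = n + 1 by omega] at hc
  omega

end Bounds

section LowerBound

variable {n : ℕ}

theorem involutive_id : Function.Involutive (id : Fin n → Fin n) := fun _ => rfl

/-- The cycles of non-identity elements in a symmetric structure whose only identity is `e`. -/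
abbrev SymCycle (e : Fin n) :=
  CycleQuot (coreperm (I := {e}) involutive_id fun _ => Iff.rfl)
    (coreperm_mul_self (I := {e}) involutive_id fun _ => Iff.rfl)

theorem card_symCycle (e : Fin n) : Nat.card (SymCycle e) = (n + 1).choose 3 := by
  have h := two_mul_card_cycleQuot_add (I := {e}) involutive_id (fun _ => Iff.rfl)
    (Finset.card_singleton e) (fun _ _ => rfl)
  simp only [id, ne_eq, not_true_eq_false, Finset.filter_false, Finset.card_empty, zero_mul,
    add_zero] at h
  exact Nat.eq_of_mul_eq_mul_left two_pos h

/-- The class of a triple of non-identity elements. -/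
def symMk (e : Fin n) (x : Fin 3 → {x // x ∉ ({e} : Finset (Fin n))}) : SymCycle e := Quot.mk _ x

theorem symMk_swap (e : Fin n) (x : Fin 3 → {x // x ∉ ({e} : Finset (Fin n))}) {i j : Fin 3}
    (hij : i ≠ j) : symMk e (fun k => x (swap i j k)) = symMk e x := by
  refine ((quot_mk_eq_iff _ _ _).2 ⟨swap i j, ?_⟩).symm
  funext k
  rw [cycleHom_swap _ _ hij]
  rfl

open Classical in
/-- The relation of the symmetric integral structure with identity `e` and cycles `A`. -/
noncomputable def symRelation (e : Fin n) (A : Set (SymCycle e)) :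
    Finset (Fin n × Fin n × Fin n) :=
  Finset.univ.filter fun t => t.1 = e ∧ t.2.1 = t.2.2 ∨ t.2.1 = e ∧ t.1 = t.2.2 ∨
    t.2.2 = e ∧ t.1 = t.2.1 ∨ ∃ x, symMk e x ∈ A ∧ t = ((x 0).1, (x 1).1, (x 2).1)

theorem mem_symRelation_iff (e : Fin n) (A : Set (SymCycle e)) (a b c : Fin n) :
    (a, b, c) ∈ symRelation e A ↔ a = e ∧ b = c ∨ b = e ∧ a = c ∨ c = e ∧ a = b ∨
      ∃ x, symMk e x ∈ A ∧ a = x 0 ∧ b = x 1 ∧ c = x 2 := by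
  simp [symRelation]

theorem isFAS_symRelation (e : Fin n) (A : Set (SymCycle e)) :
    IsFAS (id, {e}, symRelation e A) := by
  refine ⟨fun a b c h => ?_, fun a b => ?_⟩
  · simp only [mem_symRelation_iff, id] at h ⊢
    rcases h with ⟨rfl, rfl⟩ | ⟨rfl, rfl⟩ | ⟨rfl, rfl⟩ | ⟨x, hx, rfl, rfl, rfl⟩
    · simp
    · simp
    · simp
    · refine ⟨.inr (.inr (.inr ⟨fun k => x (swap 1 2 k), ?_, rfl, rfl, rfl⟩)),
        .inr (.inr (.inr ⟨fun k => x (swap 0 2 k), ?_, rfl, rfl, rfl⟩))⟩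
      · rwa [symMk_swap e x (by decide)]
      · rwa [symMk_swap e x (by decide)]
  · simp only [mem_symRelation_iff, Finset.mem_singleton, exists_eq_left]
    constructor
    · rintro rfl
      simp
    · rintro (⟨rfl, rfl⟩ | ⟨-, rfl⟩ | ⟨rfl, rfl⟩ | ⟨x, hx, rfl, h, rfl⟩)
      · rfl
      · rfl
      · rfl
      · exact absurd (Finset.mem_singleton.2 h.symm) (x 1).2

theorem symRelation_injective (e : Fin n) : Function.Injective (symRelation e) := by
  intro A A' h
  have key : ∀ A x, ((x 0).1, (x 1).1, (x 2).1) ∈ symRelation e A ↔ symMk e x ∈ A := by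
    intro A x
    have hx : ∀ i, (x i).1 ≠ e := fun i hi => (x i).2 (Finset.mem_singleton.2 hi)
    simp only [mem_symRelation_iff, hx, false_and, false_or]
    refine ⟨?_, fun h => ⟨x, h, rfl, rfl, rfl⟩⟩
    rintro ⟨y, hy, h0, h1, h2⟩
    have : x = y := by
      funext i
      fin_cases i
      · exact Subtype.ext h0
      · exact Subtype.ext h1
      · exact Subtype.ext h2
    rwa [this]
  ext q
  obtain ⟨x, rfl⟩ := Quot.exists_rep q
  have hx := key A x
  rw [h, key A' x] at hx
  exact hx.symm

theorem card_typical_ge (n : ℕ) : n * 2 ^ (n + 1).choose 3 ≤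
    Nat.card {M : FASData n // IsFAS M ∧ FASSymmetric M ∧ FASIntegral M} := by
  classical
  have hc : Nat.card (Σ e : Fin n, Set (SymCycle e)) = n * 2 ^ (n + 1).choose 3 := by
    rw [Nat.card_sigma]
    have : ∀ e : Fin n, Nat.card (Set (SymCycle e)) = 2 ^ (n + 1).choose 3 := by
      intro e
      have := Fintype.ofFinite (SymCycle e)
      rw [← card_symCycle e, Nat.card_eq_fintype_card, Nat.card_eq_fintype_card, Fintype.card_set]
    simp [this]
  rw [← hc]
  refine Nat.card_le_card_of_injective (fun p => ⟨(id, {p.1}, symRelation p.1 p.2),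
    isFAS_symRelation _ _, fun _ => rfl, Finset.card_singleton _⟩) ?_
  rintro ⟨e, A⟩ ⟨e', A'⟩ h
  simp only [Subtype.mk.injEq, Prod.mk.injEq, Finset.singleton_inj, true_and] at h
  obtain ⟨rfl, h⟩ := h
  rw [symRelation_injective e h]

end LowerBound

section UpperBound

variable {n : ℕ}

/-- The number of cycles saved by a nontrivial automorphism or a second identity. -/
def saving (n : ℕ) : ℕ := (n - 3) / 2 * ((n - 3) / 2) / 6

theorem saving_le (n : ℕ) : 24 * saving n ≤ n * n := by
  have h1 : 6 * saving n ≤ (n - 3) / 2 * ((n - 3) / 2) := Nat.mul_div_le _ _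
  have h2 : 2 * ((n - 3) / 2) ≤ n := by omega
  nlinarith [Nat.mul_le_mul h2 h2]

theorem le_saving (hn : 30 ≤ n) : n * n ≤ 40 * saving n := by
  have h1 : (n - 3) / 2 * ((n - 3) / 2) ≤ 6 * saving n + 5 := by unfold saving; omega
  have h2 : n ≤ 2 * ((n - 3) / 2) + 4 := by omega
  nlinarith [Nat.mul_le_mul h2 h2]

theorem saving_le_choose (hn : 2 ≤ n) : saving n ≤ (n + 1).choose 3 := by
  have h1 := saving_le n
  obtain ⟨m, rfl⟩ : ∃ m, n = m + 1 := ⟨n - 1, by omega⟩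
  have h2 := six_mul_choose m
  nlinarith

theorem exponent_add_saving_le {k : ℕ} (hk : 2 ≤ k) (hkn : k ≤ n) :
    k * (n - k) + (n - k + 2).choose 3 + saving n ≤ (n + 1).choose 3 := by
  have h1 := saving_le n
  obtain ⟨m, rfl⟩ : ∃ m, n = m + k := ⟨n - k, by omega⟩
  obtain ⟨d, rfl⟩ : ∃ d, k = d + 2 := ⟨k - 2, by omega⟩
  have h2 := six_mul_choose m
  have h3 := six_mul_choose (m + d + 1)
  rw [Nat.add_sub_cancel]
  rw [show m + d + 1 + 2 = m + (d + 2) + 1 by ring] at h3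
  have h4 : 24 * ((d + 2) * m) + 4 * (m ^ 3 + 3 * (m * m) + 2 * m) +
      (m + (d + 2)) * (m + (d + 2)) ≤ 4 * ((m + d + 1) ^ 3 + 3 * ((m + d + 1) * (m + d + 1)) +
        2 * (m + d + 1)) := by
    zify
    nlinarith [sq_nonneg ((m : ℤ) - 1), mul_nonneg (Int.natCast_nonneg m) (Int.natCast_nonneg d),
      mul_nonneg (mul_nonneg (Int.natCast_nonneg m) (Int.natCast_nonneg m)) (Int.natCast_nonneg d),
      mul_nonneg (mul_nonneg (Int.natCast_nonneg m) (Int.natCast_nonneg d)) (Int.natCast_nonneg d),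
      mul_nonneg (mul_nonneg (Int.natCast_nonneg d) (Int.natCast_nonneg d)) (Int.natCast_nonneg d),
      Int.natCast_nonneg m, Int.natCast_nonneg d]
  omega

/-- The relative cost of an element moved by `f`. -/
noncomputable def weight (n : ℕ) : ℝ := (√2)⁻¹ ^ (n - 1)

theorem weight_nonneg (n : ℕ) : 0 ≤ weight n := by unfold weight; positivity

/-- The relative weight of a function. -/
noncomputable def mapWeight (f : Fin n → Fin n) : ℝ := ∏ x, if f x = x then 1 else weight n

theorem mapWeight_nonneg (f : Fin n → Fin n) : 0 ≤ mapWeight f :=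
  Finset.prod_nonneg fun x _ => by split_ifs <;> simp [weight_nonneg]

theorem mapWeight_id : mapWeight (id : Fin n → Fin n) = 1 := by simp [mapWeight]

theorem sum_mapWeight_le (n : ℕ) : ∑ f : Fin n → Fin n, mapWeight f ≤ (1 + n * weight n) ^ n := by
  have h := Finset.prod_univ_sum (fun _ : Fin n => (Finset.univ : Finset (Fin n)))
    (fun x y => if y = x then (1 : ℝ) else weight n)
  rw [Fintype.piFinset_univ] at h
  unfold mapWeight
  rw [← h]
  calc ∏ x : Fin n, ∑ y : Fin n, (if y = x then (1 : ℝ) else weight n)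
      ≤ ∏ x : Fin n, (1 + n * weight n) := by
        refine Finset.prod_le_prod (fun x _ => Finset.sum_nonneg fun y _ => ?_) fun x _ => ?_
        · split_ifs <;> simp [weight_nonneg]
        · calc ∑ y : Fin n, (if y = x then (1 : ℝ) else weight n)
              ≤ ∑ y : Fin n, ((if y = x then (1 : ℝ) else 0) + weight n) :=
                Finset.sum_le_sum fun y _ => by split_ifs <;> simp [weight_nonneg]
            _ = 1 + n * weight n := by simp [Finset.sum_add_distrib]
    _ = (1 + n * weight n) ^ n := by simp

theorem two_pow_eq_mul_mapWeight {f : Fin n → Fin n} {c C : ℕ}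
    (h : 2 * c + (Finset.univ.filter fun x => f x ≠ x).card * (n - 1) = 2 * C) :
    (2 : ℝ) ^ c = 2 ^ C * mapWeight f := by
  have hw : mapWeight f = (√2)⁻¹ ^ ((Finset.univ.filter fun x => f x ≠ x).card * (n - 1)) := by
    rw [mapWeight, Finset.prod_ite, Finset.prod_const_one, one_mul, Finset.prod_const, weight,
      ← pow_mul, mul_comm]
  have h2 : (2 : ℝ) = √2 ^ 2 := by simp
  have hpow : ∀ k, (2 : ℝ) ^ k = √2 ^ (2 * k) := fun k => by rw [pow_mul, ← h2]
  rw [hw, hpow, hpow, ← h, pow_add, mul_assoc, ← mul_pow, mul_inv_cancel₀ (by positivity), one_pow,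
    mul_one]

/-- The atypical relations on `f` and `I` invariant under `g`. -/
abbrev AtypicalRelation (g : Perm (Fin n)) (f : Fin n → Fin n) (I : Finset (Fin n)) :=
  {T : Finset (Fin n × Fin n × Fin n) // (IsFAS (f, I, T) ∧
    ¬ (FASSymmetric (f, I, T) ∧ FASIntegral (f, I, T))) ∧ transport n g (f, I, T) = (f, I, T)}

theorem card_atypicalRelation_le (hn : 3 ≤ n) (g : Perm (Fin n)) (f : Fin n → Fin n)
    (I : Finset (Fin n)) : (Nat.card (AtypicalRelation g f I) : ℝ) ≤
      2 ^ (n + 1).choose 3 * ((2 ^ saving n)⁻¹ +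
        if g = 1 ∧ f ≠ id ∧ I.card = 1 then mapWeight f else 0) := by
  have hite : 0 ≤ if g = 1 ∧ f ≠ id ∧ I.card = 1 then mapWeight f else 0 := by
    split_ifs <;> simp [mapWeight_nonneg]
  by_cases hne : Nonempty (AtypicalRelation g f I)
  swap
  · rw [not_nonempty_iff] at hne
    rw [Nat.card_of_isEmpty, Nat.cast_zero]
    positivity
  obtain ⟨T, ⟨hT, hbad⟩, haut⟩ := hne
  have hf := involutive hT
  have hI := map_mem_iff hT
  have hle : Nat.card (AtypicalRelation g f I) ≤ Nat.card {T | IsFAS (f, I, T)} :=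
    Nat.card_le_card_of_injective (fun T => ⟨T.1, T.2.1.1⟩) fun a b h => by
      simpa [Subtype.ext_iff] using h
  have hsave : ∀ k, k + saving n ≤ (n + 1).choose 3 → Nat.card (AtypicalRelation g f I) ≤ 2 ^ k →
      (Nat.card (AtypicalRelation g f I) : ℝ) ≤ 2 ^ (n + 1).choose 3 * ((2 ^ saving n)⁻¹ +
        if g = 1 ∧ f ≠ id ∧ I.card = 1 then mapWeight f else 0) := by
    intro k hk hc
    calc (Nat.card (AtypicalRelation g f I) : ℝ) ≤ 2 ^ k := by exact_mod_cast hc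
      _ = 2 ^ (k + saving n) * (2 ^ saving n)⁻¹ := by
        rw [pow_add, mul_assoc, mul_inv_cancel₀ (by positivity), mul_one]
      _ ≤ 2 ^ (n + 1).choose 3 * (2 ^ saving n)⁻¹ := by
        gcongr
        norm_num
      _ ≤ _ := by
        gcongr
        exact le_add_of_nonneg_right hite
  by_cases h1 : I.card = 1
  · by_cases hg : g = 1
    · have hid : f ≠ id := by
        rintro rfl
        exact hbad ⟨fun _ => rfl, h1⟩
      rw [if_pos ⟨hg, hid, h1⟩]
      calc (Nat.card (AtypicalRelation g f I) : ℝ)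
          ≤ 2 ^ Nat.card (CycleQuot (coreperm hf hI) (coreperm_mul_self hf hI)) := by
            exact_mod_cast hle.trans (card_relations_le_integral hf hI h1)
        _ = 2 ^ (n + 1).choose 3 * mapWeight f :=
            two_pow_eq_mul_mapWeight (two_mul_card_cycleQuot_add hf hI h1
              fun i hi => fixed_of_mem hT hi)
        _ ≤ _ := by
            gcongr
            exact le_add_of_nonneg_left (by positivity)
    · have hc := card_fixed_relations_le hf hI h1 hg hn
      refine hsave _ (Nat.sub_add_cancel (saving_le_choose (by omega))).le (le_trans ?_ hc)
      exact Nat.card_le_card_of_injective (fun T => ⟨T.1, T.2.1.1, T.2.2⟩) fun a b h => by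
        simpa [Subtype.ext_iff] using h
  · have hpos : 0 < I.card := by
      obtain ⟨i, hi, -⟩ := (hT.2 ⟨0, by omega⟩ ⟨0, by omega⟩).1 rfl
      exact Finset.card_pos.2 ⟨i, hi⟩
    have hkn : I.card ≤ n := by simpa using I.card_le_univ
    exact hsave _ (exponent_add_saving_le (by omega) hkn)
      (hle.trans (card_relations_le_general hf hI))

theorem card_atypicalFixed_eq (n : ℕ) : Nat.card (AtypicalFixed n) =
    ∑ g : Perm (Fin n), ∑ f : Fin n → Fin n, ∑ I : Finset (Fin n),
      Nat.card (AtypicalRelation g f I) := by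
  have e : AtypicalFixed n ≃ Σ p : Perm (Fin n) × (Fin n → Fin n) × Finset (Fin n),
      AtypicalRelation p.1 p.2.1 p.2.2 :=
    { toFun := fun p => ⟨(p.1.1, p.1.2.1, p.1.2.2.1), p.1.2.2.2, p.2⟩
      invFun := fun p => ⟨(p.1.1, p.1.2.1, p.1.2.2, p.2.1), p.2.2⟩
      left_inv := fun _ => rfl
      right_inv := fun _ => rfl }
  rw [Nat.card_congr e, Nat.card_sigma, Fintype.sum_prod_type]
  simp only [Fintype.sum_prod_type]

theorem card_atypicalFixed_le (hn : 3 ≤ n) : (Nat.card (AtypicalFixed n) : ℝ) ≤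
    2 ^ (n + 1).choose 3 * (n.factorial * n ^ n * 2 ^ n * (2 ^ saving n)⁻¹ +
      n * ((1 + n * weight n) ^ n - 1)) := by
  classical
  have hI : ∀ w : ℝ, ∑ I : Finset (Fin n), (if I.card = 1 then w else 0) = n * w := by
    intro w
    rw [← Finset.sum_filter, Finset.sum_const, nsmul_eq_mul]
    have h := Finset.card_powersetCard 1 (Finset.univ : Finset (Fin n))
    rw [Finset.card_univ, Fintype.card_fin, Nat.choose_one_right] at h
    have hset : (Finset.univ.filter fun I : Finset (Fin n) => I.card = 1) =
        Finset.powersetCard 1 Finset.univ := by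
      ext I
      simp [Finset.mem_powersetCard]
    rw [hset, h]
  have hsum : ∑ g : Perm (Fin n), ∑ f : Fin n → Fin n, ∑ I : Finset (Fin n),
      (if g = 1 ∧ f ≠ id ∧ I.card = 1 then mapWeight f else 0) =
      n * (∑ f : Fin n → Fin n, mapWeight f - 1) := by
    rw [Finset.sum_eq_single 1 (fun g _ hg => by simp [hg]) (by simp)]
    have hf : ∀ f : Fin n → Fin n, ∑ I : Finset (Fin n),
        (if (1 : Perm (Fin n)) = 1 ∧ f ≠ id ∧ I.card = 1 then mapWeight f else 0) =
        n * mapWeight f - if f = id then (n : ℝ) else 0 := by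
      intro f
      by_cases hid : f = id
      · simp [hid, mapWeight_id]
      · simp [hid, hI]
    rw [Finset.sum_congr rfl fun f _ => hf f, Finset.sum_sub_distrib, ← Finset.mul_sum]
    simp [mul_sub]
  rw [card_atypicalFixed_eq]
  push_cast
  calc ∑ g : Perm (Fin n), ∑ f : Fin n → Fin n, ∑ I : Finset (Fin n),
        (Nat.card (AtypicalRelation g f I) : ℝ)
      ≤ ∑ g : Perm (Fin n), ∑ f : Fin n → Fin n, ∑ I : Finset (Fin n),
        2 ^ (n + 1).choose 3 * ((2 ^ saving n)⁻¹ +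
          if g = 1 ∧ f ≠ id ∧ I.card = 1 then mapWeight f else 0) :=
        Finset.sum_le_sum fun g _ => Finset.sum_le_sum fun f _ => Finset.sum_le_sum fun I _ =>
          card_atypicalRelation_le hn g f I
    _ = 2 ^ (n + 1).choose 3 * (n.factorial * n ^ n * 2 ^ n * (2 ^ saving n)⁻¹ +
          n * (∑ f : Fin n → Fin n, mapWeight f - 1)) := by
        simp only [← Finset.mul_sum, Finset.sum_add_distrib, hsum]
        simp [Fintype.card_perm, mul_assoc]
    _ ≤ _ := by
        gcongr
        exact sum_mapWeight_le n

end UpperBound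

/-- An upper bound for the ratio of atypical to typical structures. -/
noncomputable def errorBound (n : ℕ) : ℝ :=
  (2 * (n : ℝ) ^ 2) ^ n * (2 ^ saving n)⁻¹ + (Real.exp (n * (n * weight n)) - 1)

theorem card_atypicalFixed_le_errorBound {n : ℕ} (hn : 3 ≤ n) :
    (Nat.card (AtypicalFixed n) : ℝ) ≤ errorBound n * (n * 2 ^ (n + 1).choose 3) := by
  refine (card_atypicalFixed_le hn).trans ?_
  have hn1 : (1 : ℝ) ≤ n := by exact_mod_cast (by omega : 1 ≤ n)
  have hfac : (n.factorial : ℝ) ≤ n ^ n := by exact_mod_cast Nat.factorial_le_pow n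
  have hexp : (1 + n * weight n) ^ n ≤ Real.exp (n * (n * weight n)) := by
    rw [Real.exp_nat_mul]
    have := weight_nonneg n
    gcongr
    rw [add_comm]
    exact Real.add_one_le_exp _
  have hmain : (n.factorial : ℝ) * n ^ n * 2 ^ n * (2 ^ saving n)⁻¹ ≤
      n * ((2 * (n : ℝ) ^ 2) ^ n * (2 ^ saving n)⁻¹) := by
    calc (n.factorial : ℝ) * n ^ n * 2 ^ n * (2 ^ saving n)⁻¹
        ≤ n ^ n * n ^ n * 2 ^ n * (2 ^ saving n)⁻¹ := by gcongr
      _ = 1 * ((2 * (n : ℝ) ^ 2) ^ n * (2 ^ saving n)⁻¹) := by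
        rw [mul_pow, sq, mul_pow]; ring
      _ ≤ _ := by gcongr
  calc (2 : ℝ) ^ (n + 1).choose 3 * (n.factorial * n ^ n * 2 ^ n * (2 ^ saving n)⁻¹ +
        n * ((1 + n * weight n) ^ n - 1))
      ≤ 2 ^ (n + 1).choose 3 * (n * ((2 * (n : ℝ) ^ 2) ^ n * (2 ^ saving n)⁻¹) +
        n * (Real.exp (n * (n * weight n)) - 1)) := by gcongr
    _ = _ := by rw [errorBound]; ring

theorem tendsto_errorBound : Tendsto errorBound atTop (𝓝 0) := by
  have h1 : Tendsto (fun n : ℕ => (2 * (n : ℝ) ^ 2) ^ n * (2 ^ saving n)⁻¹) atTop (𝓝 0) := by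
    obtain ⟨θ, hθ0, hθ1, hθ⟩ : ∃ θ : ℝ, 0 < θ ∧ θ < 1 ∧ θ ^ 40 = 2⁻¹ := by
      refine ⟨(2⁻¹ : ℝ) ^ ((40 : ℕ) : ℝ)⁻¹, by positivity,
        Real.rpow_lt_one (by norm_num) (by norm_num) (by norm_num),
        Real.rpow_inv_natCast_pow (by norm_num) (by norm_num)⟩
    have hlim : Tendsto (fun n : ℕ => 2 * ((n : ℝ) ^ 2 * θ ^ n)) atTop (𝓝 0) := by
      simpa using (tendsto_pow_const_mul_const_pow_of_abs_lt_one 2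
        (by rwa [abs_of_pos hθ0] : |θ| < 1)).const_mul 2
    refine squeeze_zero' (Eventually.of_forall fun n => by positivity) ?_ hlim
    filter_upwards [eventually_ge_atTop 30, hlim.eventually (gt_mem_nhds one_pos)] with n hn hlt
    calc (2 * (n : ℝ) ^ 2) ^ n * (2 ^ saving n)⁻¹
        = (2 * (n : ℝ) ^ 2) ^ n * θ ^ (40 * saving n) := by rw [pow_mul, hθ, inv_pow]
      _ ≤ (2 * (n : ℝ) ^ 2) ^ n * θ ^ (n * n) := by
        gcongr ?_ * ?_
        exact pow_le_pow_of_le_one hθ0.le hθ1.le (le_saving hn)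
      _ = (2 * ((n : ℝ) ^ 2 * θ ^ n)) ^ n := by rw [pow_mul, ← mul_pow, mul_assoc]
      _ ≤ 2 * ((n : ℝ) ^ 2 * θ ^ n) := pow_le_of_le_one (by positivity) hlt.le (by omega)
  have h2 : Tendsto (fun n : ℕ => (n : ℝ) * (n * weight n)) atTop (𝓝 0) := by
    have hs : (√2)⁻¹ < 1 := inv_lt_one_of_one_lt₀ (Real.lt_sqrt_of_sq_lt (by norm_num))
    have hlim := (tendsto_pow_const_mul_const_pow_of_abs_lt_one 2
      (by rwa [abs_of_pos (by positivity)] : |(√2)⁻¹| < 1)).const_mul √2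
    rw [mul_zero] at hlim
    refine hlim.congr' ?_
    filter_upwards [eventually_ge_atTop 1] with n hn
    obtain ⟨m, rfl⟩ : ∃ m, n = m + 1 := ⟨n - 1, by omega⟩
    rw [weight, Nat.add_sub_cancel, pow_succ (√2)⁻¹ m]
    field_simp
  have h3 : Tendsto (fun n : ℕ => Real.exp (n * (n * weight n)) - 1) atTop (𝓝 0) := by
    simpa using ((Real.continuous_exp.tendsto 0).comp h2).sub_const 1
  have h := h1.add h3
  rw [add_zero] at h
  exact h

end FASCount

/-- Almost all unlabelled FAS structures are symmetric and integral. -/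
theorem stmt1 :
    Tendsto (fun n : ℕ => (vCount n : ℝ) / (uCount n : ℝ)) atTop (𝓝 1) := by
  have hlow : Tendsto (fun n => 1 - FASCount.errorBound n) atTop (𝓝 1) := by
    simpa using FASCount.tendsto_errorBound.const_sub 1
  refine tendsto_of_tendsto_of_tendsto_of_le_of_le' hlow tendsto_const_nhds ?_ ?_
  all_goals
    filter_upwards [eventually_ge_atTop 3] with n hn
    have hfac : (0 : ℝ) < n.factorial := by exact_mod_cast n.factorial_pos
    have hu : (uCount n : ℝ) * n.factorial =
        vCount n * n.factorial + Nat.card (FASCount.AtypicalFixed n) := by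
      exact_mod_cast FASCount.uCount_mul_factorial n
    have hv : (n : ℝ) * 2 ^ (n + 1).choose 3 ≤ vCount n * n.factorial := by
      exact_mod_cast (FASCount.card_typical_ge n).trans
        (FASCount.card_typical_le_vCount_mul_factorial n)
    have hn0 : (0 : ℝ) < n := by exact_mod_cast (by omega : 0 < n)
    have hbase : (0 : ℝ) < n * 2 ^ (n + 1).choose 3 := by positivity
    have hA := FASCount.card_atypicalFixed_le_errorBound hn
    have hA0 : (0 : ℝ) ≤ Nat.card (FASCount.AtypicalFixed n) := Nat.cast_nonneg _
    have hupos : (0 : ℝ) < uCount n := by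
      refine pos_of_mul_pos_left ?_ hfac.le
      linarith
  · have herr : 0 ≤ FASCount.errorBound n := nonneg_of_mul_nonneg_left (hA0.trans hA) hbase
    rw [le_div_iff₀ hupos]
    refine le_of_mul_le_mul_right ?_ hfac
    nlinarith
  · rw [div_le_one hupos]
    refine le_of_mul_le_mul_right ?_ hfac
    linarith
end
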